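/- arXiv:1603.07365 — 6 statements merged into one kernel-verified Lean document; each statement's English description precedes it below -/
import Mathlib

section
/- (von Bahr's formula.) Let p > 0 be a real number that is not an even integer, set ℓ := ⌈p−1⌉, and let X be a real random variable with E|X|^p < ∞ and characteristic function f. Then E|X|^p = −(2·Γ(p+1)/π)·sin(πp/2) · ∫_0^∞ Re( f(t) − Σ_{j=0}^{ℓ} f^{(j)}(0)·t^j/j! )/t^{p+1} dt, where f^{(j)} is the j-th derivative of f and the integral exists in the Lebesgue sense. -/
open MeasureTheory Filter Set Topology

/-- The characteristic function of a real random variable `X` on `(Ω, μ)`. -/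
noncomputable def cf {Ω : Type*} [MeasurableSpace Ω] (μ : Measure Ω) (X : Ω → ℝ) (t : ℝ) : ℂ :=
  ∫ ω, Complex.exp (Complex.I * t * X ω) ∂μ

/-- Tonelli's theorem for a nonnegative real kernel with known marginal integrals `A` and `B`:
integrability of `A` passes to `B`, and the two integrals agree. -/
theorem integrable_and_integral_eq_of_nonneg {α β : Type*} [MeasurableSpace α] [MeasurableSpace β]
    {μ : Measure α} {ν : Measure β} [SFinite μ] [SFinite ν] {F : α → β → ℝ} {A : α → ℝ}
    {B : β → ℝ} (hF : AEStronglyMeasurable (Function.uncurry F) (μ.prod ν))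
    (hF0 : ∀ᵐ a ∂μ, ∀ᵐ b ∂ν, 0 ≤ F a b) (hFi : ∀ᵐ a ∂μ, Integrable (F a) ν)
    (hA : ∀ᵐ a ∂μ, ∫ b, F a b ∂ν = A a) (hAi : Integrable A μ)
    (hB : ∀ᵐ b ∂ν, ∫ a, F a b ∂μ = B b) :
    Integrable B ν ∧ ∫ b, B b ∂ν = ∫ a, A a ∂μ := by
  have hint : Integrable (Function.uncurry F) (μ.prod ν) := by
    refine (integrable_prod_iff hF).2 ⟨hFi, hAi.congr ?_⟩
    filter_upwards [hF0, hA] with a h0 ha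
    rw [← ha]
    refine integral_congr_ae ?_
    filter_upwards [h0] with b hb
    exact (Real.norm_of_nonneg hb).symm
  refine ⟨hint.integral_prod_right.congr hB, ?_⟩
  rw [← integral_congr_ae hB, ← integral_congr_ae hA]
  exact (integral_integral_swap hint).symm

/-- The remainder of the Maclaurin expansion of `cos` after `m` nonzero terms, with the sign that
makes it nonnegative. -/
noncomputable def cosRemainder (m : ℕ) (u : ℝ) : ℝ :=
  (-1) ^ m * (Real.cos u - ∑ k ∈ Finset.range m, (-1) ^ k * u ^ (2 * k) / (2 * k).factorial)

/-- The remainder of the Maclaurin expansion of `sin` after `m` nonzero terms, with the sign that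
makes it nonnegative on the positive half-line. -/
noncomputable def sinRemainder (m : ℕ) (u : ℝ) : ℝ :=
  (-1) ^ m *
    (Real.sin u - ∑ k ∈ Finset.range m, (-1) ^ k * u ^ (2 * k + 1) / (2 * k + 1).factorial)

theorem continuous_cosRemainder (m : ℕ) : Continuous (cosRemainder m) := by
  unfold cosRemainder; fun_prop

theorem hasDerivAt_sinRemainder (m : ℕ) (u : ℝ) :
    HasDerivAt (sinRemainder m) (cosRemainder m u) u := by
  refine ((Real.hasDerivAt_sin u).sub (HasDerivAt.fun_sum fun k _ => ?_)).const_mul _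
  convert! ((hasDerivAt_pow (2 * k + 1) u).const_mul ((-1 : ℝ) ^ k)).div_const
    ((2 * k + 1).factorial : ℝ) using 1
  rw [Nat.factorial_succ]
  push_cast
  field_simp

theorem hasDerivAt_cosRemainder_succ (m : ℕ) (u : ℝ) :
    HasDerivAt (cosRemainder (m + 1)) (sinRemainder m u) u := by
  unfold cosRemainder
  simp_rw [Finset.sum_range_succ']
  have h := ((Real.hasDerivAt_cos u).sub ((HasDerivAt.fun_sum (u := Finset.range m) fun k _ =>
    ((hasDerivAt_pow (2 * (k + 1)) u).const_mul ((-1 : ℝ) ^ (k + 1))).div_const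
      ((2 * (k + 1)).factorial : ℝ)).add_const
      ((-1 : ℝ) ^ 0 * u ^ (2 * 0) / (2 * 0).factorial))).const_mul ((-1 : ℝ) ^ (m + 1))
  convert! h using 1
  have hterm : ∀ k ∈ Finset.range m,
      (-1 : ℝ) ^ (k + 1) * (((2 * (k + 1) : ℕ) : ℝ) * u ^ (2 * (k + 1) - 1)) /
        (2 * (k + 1)).factorial =
      -((-1) ^ k * u ^ (2 * k + 1) / (2 * k + 1).factorial) := by
    intro k _
    rw [show 2 * (k + 1) = 2 * k + 1 + 1 by ring, Nat.factorial_succ, Nat.add_sub_cancel, pow_succ]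
    push_cast
    field_simp
  rw [Finset.sum_congr rfl hterm, Finset.sum_neg_distrib, sinRemainder, pow_succ]
  ring

theorem cosRemainder_succ_zero (m : ℕ) : cosRemainder (m + 1) 0 = 0 := by
  simp [cosRemainder, Finset.sum_range_succ']

theorem sinRemainder_zero (m : ℕ) : sinRemainder m 0 = 0 := by
  simp [sinRemainder]

theorem nonneg_of_hasDerivAt_nonneg {g g' : ℝ → ℝ} (hg : ∀ u, HasDerivAt g (g' u) u)
    (hg0 : g 0 = 0) (hg' : ∀ u, 0 ≤ u → 0 ≤ g' u) {u : ℝ} (hu : 0 ≤ u) : 0 ≤ g u := by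
  have hmono : MonotoneOn g (Ici 0) := by
    refine monotoneOn_of_deriv_nonneg (convex_Ici 0)
      (fun x _ => (hg x).continuousAt.continuousWithinAt)
      (fun x _ => (hg x).differentiableAt.differentiableWithinAt) fun x hx => ?_
    rw [interior_Ici] at hx
    rw [(hg x).deriv]
    exact hg' x (le_of_lt hx)
  simpa [hg0] using hmono self_mem_Ici hu hu

theorem cosRemainder_neg (m : ℕ) (u : ℝ) : cosRemainder m (-u) = cosRemainder m u := by
  simp [cosRemainder, pow_mul]

theorem cosRemainder_abs (m : ℕ) (u : ℝ) : cosRemainder m |u| = cosRemainder m u := by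
  rcases abs_choice u with h | h <;> rw [h]
  exact cosRemainder_neg m u

theorem cosRemainder_succ_nonneg (m : ℕ) (u : ℝ) : 0 ≤ cosRemainder (m + 1) u := by
  have key : ∀ v, 0 ≤ v → 0 ≤ cosRemainder (m + 1) v := by
    induction m with
    | zero => intro v _; simp [cosRemainder, Real.cos_le_one]
    | succ m ih =>
      exact fun v hv => nonneg_of_hasDerivAt_nonneg (hasDerivAt_cosRemainder_succ (m + 1))
        (cosRemainder_succ_zero _) (fun w hw => nonneg_of_hasDerivAt_nonneg
          (hasDerivAt_sinRemainder (m + 1)) (sinRemainder_zero _) ih hw) hv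
  rw [← cosRemainder_abs]
  exact key _ (abs_nonneg u)

theorem integrableOn_rpow_mul_exp_neg_mul_Ioi {a r : ℝ} (ha : 0 < a) (hr : 0 < r) :
    IntegrableOn (fun t : ℝ => t ^ (a - 1) * Real.exp (-(r * t))) (Ioi 0) := by
  simpa using integrableOn_rpow_mul_exp_neg_mul_rpow (s := a - 1) (by linarith) one_pos hr

theorem integrableOn_pow_mul_exp_neg_mul_Ioi (n : ℕ) {s : ℝ} (hs : 0 < s) :
    IntegrableOn (fun u : ℝ => u ^ n * Real.exp (-(s * u))) (Ioi 0) := by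
  simpa using integrableOn_rpow_mul_exp_neg_mul_Ioi (a := n + 1) (by positivity) hs

theorem integral_pow_mul_exp_neg_mul_Ioi (n : ℕ) {s : ℝ} (hs : 0 < s) :
    ∫ u in Ioi (0 : ℝ), u ^ n * Real.exp (-(s * u)) = n.factorial / s ^ (n + 1) := by
  have h := Real.integral_rpow_mul_exp_neg_mul_Ioi (a := n + 1) (by positivity) hs
  rw [Real.Gamma_nat_eq_factorial] at h
  simp only [add_sub_cancel_right, Real.rpow_natCast] at h
  rw [h, show ((n : ℝ) + 1) = ((n + 1 : ℕ) : ℝ) by push_cast; ring, Real.rpow_natCast,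
    one_div_pow, one_div_mul_eq_div]

theorem cos_mul_exp_neg_mul_eq_re (s u : ℝ) :
    Real.cos u * Real.exp (-(s * u)) = (Complex.exp ((-s + Complex.I) * u)).re := by
  rw [Complex.exp_re]; simp [mul_comm]

theorem integrableOn_cos_mul_exp_neg_mul_Ioi {s : ℝ} (hs : 0 < s) :
    IntegrableOn (fun u : ℝ => Real.cos u * Real.exp (-(s * u))) (Ioi 0) := by
  simp_rw [cos_mul_exp_neg_mul_eq_re]
  exact (integrableOn_exp_mul_complex_Ioi (a := -s + Complex.I) (by simpa) 0).re

theorem integral_cos_mul_exp_neg_mul_Ioi {s : ℝ} (hs : 0 < s) :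
    ∫ u in Ioi (0 : ℝ), Real.cos u * Real.exp (-(s * u)) = s / (1 + s ^ 2) := by
  simp_rw [cos_mul_exp_neg_mul_eq_re]
  have hre : (-s + Complex.I : ℂ).re < 0 := by simpa
  have h := integral_re (integrableOn_exp_mul_complex_Ioi hre 0)
  simp only [RCLike.re_to_complex] at h
  rw [h, integral_exp_mul_complex_Ioi hre]
  simp [Complex.div_re, Complex.normSq_apply]
  field_simp
  ring

theorem cosRemainder_mul (m : ℕ) (u c : ℝ) : cosRemainder m u * c = (-1) ^ m * (Real.cos u * c -
    ∑ k ∈ Finset.range m, (-1) ^ k / (2 * k).factorial * (u ^ (2 * k) * c)) := by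
  rw [cosRemainder, mul_assoc, sub_mul, Finset.sum_mul]
  congr 2
  exact Finset.sum_congr rfl fun k _ => by ring

theorem integrableOn_cosRemainder_mul_exp_neg_mul_Ioi (m : ℕ) {s : ℝ} (hs : 0 < s) :
    IntegrableOn (fun u => cosRemainder m u * Real.exp (-(s * u))) (Ioi 0) := by
  simp_rw [cosRemainder_mul]
  exact ((integrableOn_cos_mul_exp_neg_mul_Ioi hs).sub (integrable_finsetSum _ fun k _ =>
    (integrableOn_pow_mul_exp_neg_mul_Ioi (2 * k) hs).const_mul _)).const_mul _

/-- The Laplace transform of `cosRemainder m`. -/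
theorem integral_cosRemainder_mul_exp_neg_mul_Ioi (m : ℕ) {s : ℝ} (hs : 0 < s) :
    ∫ u in Ioi (0 : ℝ), cosRemainder m u * Real.exp (-(s * u)) =
      s / (s ^ (2 * m) * (1 + s ^ 2)) := by
  simp_rw [cosRemainder_mul]
  have hi : ∀ k ∈ Finset.range m, Integrable (fun u : ℝ => (-1) ^ k / (2 * k).factorial *
      (u ^ (2 * k) * Real.exp (-(s * u)))) (volume.restrict (Ioi 0)) := fun k _ =>
    (integrableOn_pow_mul_exp_neg_mul_Ioi (2 * k) hs).const_mul _
  rw [integral_const_mul, integral_sub (integrableOn_cos_mul_exp_neg_mul_Ioi hs)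
    (integrable_finsetSum _ hi), integral_finsetSum _ hi, integral_cos_mul_exp_neg_mul_Ioi hs]
  simp_rw [integral_const_mul, integral_pow_mul_exp_neg_mul_Ioi _ hs]
  clear hi
  induction m with
  | zero => simp
  | succ m ih =>
    rw [Finset.sum_range_succ, pow_succ, ← sub_sub, mul_sub, mul_assoc, neg_one_mul, mul_neg, ih]
    have hsign : ((-1 : ℝ) ^ m) * (-1) ^ m = 1 := by rw [← mul_pow]; simp
    have hterm : (-1 : ℝ) ^ m * -1 * ((-1) ^ m / (2 * m).factorial *
        ((2 * m).factorial / s ^ (2 * m + 1))) = - (1 / s ^ (2 * m + 1)) := by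
      field_simp
      linear_combination -hsign
    rw [hterm]
    field_simp
    ring

theorem integrableOn_and_integral_rpow_div_one_add_sq {a : ℝ} (ha0 : 0 < a) (ha2 : a < 2) :
    IntegrableOn (fun s : ℝ => s ^ (a - 1) / (1 + s ^ 2)) (Ioi 0) ∧
    ∫ s in Ioi (0 : ℝ), s ^ (a - 1) / (1 + s ^ 2) = Real.pi / (2 * Real.sin (Real.pi * a / 2)) := by
  have hA := integrableOn_rpow_mul_exp_neg_mul_Ioi (a := 1 - a / 2) (by linarith) one_pos
  have hAv := Real.integral_rpow_mul_exp_neg_mul_Ioi (a := 1 - a / 2) (by linarith) one_pos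
  obtain ⟨h1, h2⟩ := integrable_and_integral_eq_of_nonneg (μ := volume.restrict (Ioi (0 : ℝ)))
    (ν := volume.restrict (Ioi (0 : ℝ)))
    (F := fun v s => s ^ (a - 1) * Real.exp (-(v * s ^ (2 : ℝ))) * Real.exp (-v))
    (A := fun v => Real.Gamma (a / 2) / 2 * (v ^ (1 - a / 2 - 1) * Real.exp (-(1 * v))))
    (B := fun s => s ^ (a - 1) / (1 + s ^ 2))
    (by apply Measurable.aestronglyMeasurable; unfold Function.uncurry; fun_prop)
    (.of_forall fun v => ae_restrict_of_forall_mem measurableSet_Ioi fun s hs => by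
      have : (0 : ℝ) < s := hs
      positivity)
    (ae_restrict_of_forall_mem measurableSet_Ioi fun v hv => by
      simpa using (integrableOn_rpow_mul_exp_neg_mul_rpow (s := a - 1) (by linarith) two_pos
        hv).mul_const (Real.exp (-v)))
    (ae_restrict_of_forall_mem measurableSet_Ioi fun v hv => by
      have h := integral_rpow_mul_exp_neg_mul_rpow (q := a - 1) two_pos (by linarith) hv
      simp only [neg_mul, sub_add_cancel] at h
      rw [integral_mul_const, h, show 1 - a / 2 - 1 = -a / 2 by ring]
      ring_nf)
    (hA.const_mul _)
    (ae_restrict_of_forall_mem measurableSet_Ioi fun s hs => by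
      have h := integral_exp_mul_Ioi (a := -(1 + s ^ 2)) (by linarith [sq_nonneg s]) 0
      simp_rw [mul_assoc, ← Real.exp_add]
      rw [integral_const_mul, div_eq_mul_inv]
      congr 1
      convert! h using 1
      · congr 1 with v
        norm_num
        ring
      · rw [mul_zero, Real.exp_zero, neg_div_neg_eq, one_div])
  refine ⟨h1, h2.trans ?_⟩
  rw [integral_const_mul, hAv]
  have := Real.Gamma_mul_Gamma_one_sub (a / 2)
  rw [show Real.pi * (a / 2) = Real.pi * a / 2 by ring] at this
  simp only [div_one, Real.one_rpow, one_mul]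
  rw [div_mul_eq_mul_div, this]
  ring

theorem integrableOn_and_integral_cosRemainder_div_rpow {m : ℕ} {p : ℝ} (hp0 : 0 < p)
    (hp1 : 2 * m < p) (hp2 : p < 2 * m + 2) :
    IntegrableOn (fun u => cosRemainder (m + 1) u / u ^ (p + 1)) (Ioi 0) ∧
    ∫ u in Ioi (0 : ℝ), cosRemainder (m + 1) u / u ^ (p + 1) =
      (-1) ^ m * (Real.pi / (2 * Real.Gamma (p + 1) * Real.sin (Real.pi * p / 2))) := by
  have hG : 0 < Real.Gamma (p + 1) := Real.Gamma_pos_of_pos (by linarith)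
  obtain ⟨hA, hAv⟩ := integrableOn_and_integral_rpow_div_one_add_sq (a := p - 2 * m)
    (by linarith) (by linarith)
  obtain ⟨h1, h2⟩ := integrable_and_integral_eq_of_nonneg (μ := volume.restrict (Ioi (0 : ℝ)))
    (ν := volume.restrict (Ioi (0 : ℝ)))
    (F := fun s u => s ^ p / Real.Gamma (p + 1) * (cosRemainder (m + 1) u * Real.exp (-(s * u))))
    (A := fun s => (Real.Gamma (p + 1))⁻¹ * (s ^ (p - 2 * m - 1) / (1 + s ^ 2)))
    (B := fun u => cosRemainder (m + 1) u / u ^ (p + 1))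
    (by
      have := (continuous_cosRemainder (m + 1)).measurable
      apply Measurable.aestronglyMeasurable; unfold Function.uncurry; fun_prop)
    (ae_restrict_of_forall_mem measurableSet_Ioi fun s hs => .of_forall fun u => by
      have : (0 : ℝ) < s := hs
      have := cosRemainder_succ_nonneg m u
      positivity)
    (ae_restrict_of_forall_mem measurableSet_Ioi fun s hs =>
      (integrableOn_cosRemainder_mul_exp_neg_mul_Ioi (m + 1) hs).const_mul _)
    (ae_restrict_of_forall_mem measurableSet_Ioi fun s hs => by
      have hs' : (0 : ℝ) < s := hs
      rw [integral_const_mul, integral_cosRemainder_mul_exp_neg_mul_Ioi (m + 1) hs,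
        show p - 2 * m - 1 = p - ((2 * m + 1 : ℕ) : ℝ) by push_cast; ring,
        Real.rpow_sub_natCast hs'.ne']
      field_simp
      ring)
    (hA.const_mul _)
    (ae_restrict_of_forall_mem measurableSet_Ioi fun u hu => by
      have hu' : (0 : ℝ) < u := hu
      have h := Real.integral_rpow_mul_exp_neg_mul_Ioi (a := p + 1) (by linarith) hu'
      rw [add_sub_cancel_right, Real.div_rpow zero_le_one hu'.le, Real.one_rpow] at h
      have h3 : ∀ s : ℝ, s ^ p / Real.Gamma (p + 1) *
          (cosRemainder (m + 1) u * Real.exp (-(s * u))) =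
          cosRemainder (m + 1) u / Real.Gamma (p + 1) * (s ^ p * Real.exp (-(u * s))) := by
        intro s; rw [mul_comm s u]; ring
      simp_rw [h3]
      rw [integral_const_mul, h]
      field_simp)
  refine ⟨h1, h2.trans ?_⟩
  rw [integral_const_mul, hAv, show Real.pi * (p - 2 * m) / 2 = Real.pi * p / 2 - m * Real.pi by
    ring, Real.sin_sub_nat_mul_pi]
  have hsign : ((-1 : ℝ) ^ m)⁻¹ = (-1) ^ m := by rw [← inv_pow]; norm_num
  simp only [div_eq_mul_inv, mul_inv, hsign]
  ring

theorem integrableOn_and_integral_cosRemainder_mul_div_rpow {m : ℕ} {p : ℝ} (hp0 : 0 < p)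
    (h : IntegrableOn (fun u => cosRemainder (m + 1) u / u ^ (p + 1)) (Ioi 0)) (x : ℝ) :
    IntegrableOn (fun t => cosRemainder (m + 1) (t * x) / t ^ (p + 1)) (Ioi 0) ∧
    ∫ t in Ioi (0 : ℝ), cosRemainder (m + 1) (t * x) / t ^ (p + 1) =
      |x| ^ p * ∫ u in Ioi (0 : ℝ), cosRemainder (m + 1) u / u ^ (p + 1) := by
  rcases eq_or_ne x 0 with rfl | hx
  · simp [cosRemainder_succ_zero, Real.zero_rpow hp0.ne']
  have hc : 0 < |x| := abs_pos.2 hx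
  have heq : EqOn (fun t => |x| ^ (p + 1) *
      (cosRemainder (m + 1) (|x| * t) / (|x| * t) ^ (p + 1)))
      (fun t => cosRemainder (m + 1) (t * x) / t ^ (p + 1)) (Ioi 0) := by
    intro t ht
    have ht' : (0 : ℝ) < t := ht
    have hct := Real.rpow_pos_of_pos hc (p + 1)
    have := Real.rpow_pos_of_pos ht' (p + 1)
    dsimp only
    rw [← cosRemainder_abs _ (t * x), abs_mul, abs_of_pos ht', mul_comm t |x|,
      Real.mul_rpow hc.le ht'.le]
    field_simp
  constructor
  · refine IntegrableOn.congr_fun (Integrable.const_mul ?_ _) heq measurableSet_Ioi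
    refine (integrableOn_Ioi_comp_mul_left_iff
      (fun u => cosRemainder (m + 1) u / u ^ (p + 1)) 0 hc).2 ?_
    simpa using h
  · rw [← setIntegral_congr_fun measurableSet_Ioi heq, integral_const_mul,
      integral_comp_mul_left_Ioi (fun u => cosRemainder (m + 1) u / u ^ (p + 1)) 0 hc,
      Real.rpow_add_one hc.ne']
    simp
    field_simp

theorem sum_range_two_mul_re_I_mul_pow_div (u : ℝ) (m : ℕ) :
    ∑ j ∈ Finset.range (2 * m), ((Complex.I * u) ^ j / j.factorial).re =
      ∑ k ∈ Finset.range m, (-1) ^ k * u ^ (2 * k) / (2 * k).factorial := by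
  have even (k : ℕ) : (Complex.I * u) ^ (2 * k) = (((-1) ^ k * u ^ (2 * k) : ℝ) : ℂ) := by
    rw [pow_mul, mul_pow, Complex.I_sq]; push_cast; rw [mul_pow, ← pow_mul]
  induction m with
  | zero => simp
  | succ m ih =>
    rw [show 2 * (m + 1) = 2 * m + 1 + 1 by ring, Finset.sum_range_succ, Finset.sum_range_succ, ih,
      Finset.sum_range_succ, pow_succ, even]
    have h1 : ((((-1) ^ m * u ^ (2 * m) : ℝ) : ℂ) / ((2 * m).factorial : ℂ)).re =
        (-1) ^ m * u ^ (2 * m) / (2 * m).factorial := by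
      norm_cast
    have h2 : ((((-1) ^ m * u ^ (2 * m) : ℝ) : ℂ) * (Complex.I * u) /
        ((2 * m + 1).factorial : ℂ)).re = 0 := by
      rw [Complex.div_natCast_re, Complex.re_ofReal_mul]; simp
    rw [h1, h2, add_zero]

theorem re_exp_I_mul_sub_sum (u : ℝ) (ℓ : ℕ) :
    (Complex.exp (Complex.I * u) -
      ∑ j ∈ Finset.range (ℓ + 1), (Complex.I * u) ^ j / j.factorial).re =
      (-1) ^ (ℓ / 2 + 1) * cosRemainder (ℓ / 2 + 1) u := by
  have hsum : ∑ j ∈ Finset.range (ℓ + 1), ((Complex.I * u) ^ j / j.factorial).re =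
      ∑ j ∈ Finset.range (2 * (ℓ / 2 + 1)), ((Complex.I * u) ^ j / j.factorial).re := by
    rcases Nat.even_or_odd' ℓ with ⟨k, rfl | rfl⟩
    · rw [show 2 * (2 * k / 2 + 1) = 2 * k + 1 + 1 by omega, Finset.sum_range_succ _ (2 * k + 1),
        Complex.div_natCast_re, pow_succ, pow_mul, mul_pow, Complex.I_sq]
      have h : ((-1 : ℂ) ^ k * (u : ℂ) ^ (2 * k) * (Complex.I * u)).re = 0 := by
        rw [show (-1 : ℂ) ^ k * (u : ℂ) ^ (2 * k) = (((-1) ^ k * u ^ (2 * k) : ℝ) : ℂ) by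
          push_cast; rfl, Complex.re_ofReal_mul]
        simp
      rw [mul_pow, ← pow_mul, h]
      simp
    · rw [show 2 * ((2 * k + 1) / 2 + 1) = 2 * k + 1 + 1 by omega]
  rw [Complex.sub_re, Complex.re_sum, hsum, sum_range_two_mul_re_I_mul_pow_div, cosRemainder,
    ← mul_assoc, ← mul_pow, mul_comm Complex.I, Complex.exp_ofReal_mul_I_re]
  simp

theorem cf_eq_charFun {Ω : Type*} [MeasurableSpace Ω] (μ : Measure Ω) {X : Ω → ℝ}
    (hX : Measurable X) : cf μ X = charFun (μ.map X) := by
  ext t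
  rw [charFun_apply_real, integral_map hX.aemeasurable (by fun_prop), cf]
  exact integral_congr_ae (.of_forall fun ω => by dsimp only; congr 1; ring)

theorem iteratedDeriv_cf_zero {Ω : Type*} [MeasurableSpace Ω] {μ : Measure Ω}
    [IsProbabilityMeasure μ] {X : Ω → ℝ} (hX : Measurable X) {j : ℕ} (hj : MemLp X j μ) :
    iteratedDeriv j (cf μ X) 0 = Complex.I ^ j * ∫ ω, (X ω : ℂ) ^ j ∂μ := by
  have := Measure.isProbabilityMeasure_map (μ := μ) hX.aemeasurable
  rw [cf_eq_charFun μ hX, iteratedDeriv_charFun_zero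
    ((memLp_map_measure_iff (by fun_prop) hX.aemeasurable).2 hj),
    integral_map hX.aemeasurable (by fun_prop), ← integral_complex_ofReal]
  simp

theorem re_cf_sub_sum {Ω : Type*} [MeasurableSpace Ω] {μ : Measure Ω} [IsProbabilityMeasure μ]
    {X : Ω → ℝ} (hX : Measurable X) {ℓ : ℕ} (hmem : MemLp X ℓ μ) (t : ℝ) :
    (cf μ X t - ∑ j ∈ Finset.range (ℓ + 1),
      iteratedDeriv j (cf μ X) 0 * (t : ℂ) ^ j / (Nat.factorial j)).re =
      (-1) ^ (ℓ / 2 + 1) * ∫ ω, cosRemainder (ℓ / 2 + 1) (t * X ω) ∂μ := by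
  have hmem' : ∀ j ∈ Finset.range (ℓ + 1), MemLp X j μ := fun j hj =>
    hmem.mono_exponent (by exact_mod_cast Finset.mem_range_succ_iff.1 hj)
  have hexp : Integrable (fun ω => Complex.exp (Complex.I * ((t * X ω : ℝ) : ℂ))) μ := by
    refine Integrable.of_bound (C := 1) (by fun_prop) (.of_forall fun ω => ?_)
    rw [mul_comm, Complex.norm_exp_ofReal_mul_I]
  have hpow : ∀ j ∈ Finset.range (ℓ + 1),
      Integrable (fun ω => (Complex.I * ((t * X ω : ℝ) : ℂ)) ^ j / j.factorial) μ := by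
    intro j hj
    have h : Integrable (fun ω => ((X ω ^ j : ℝ) : ℂ)) μ := by
      refine Integrable.ofReal (f := fun ω => X ω ^ j) ?_
      refine ((hmem' j hj).integrable_norm_pow').mono' (by fun_prop) (.of_forall fun ω => ?_)
      simp
    convert! h.const_mul (Complex.I ^ j * t ^ j / j.factorial) using 2 with ω
    push_cast; ring
  have hsum : cf μ X t - ∑ j ∈ Finset.range (ℓ + 1),
      iteratedDeriv j (cf μ X) 0 * (t : ℂ) ^ j / (Nat.factorial j) =
      ∫ ω, (Complex.exp (Complex.I * ((t * X ω : ℝ) : ℂ)) -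
        ∑ j ∈ Finset.range (ℓ + 1), (Complex.I * ((t * X ω : ℝ) : ℂ)) ^ j / j.factorial) ∂μ := by
    rw [integral_sub hexp (integrable_finsetSum _ hpow), integral_finsetSum _ hpow]
    congr 1
    · simp [cf, mul_assoc]
    · refine Finset.sum_congr rfl fun j hj => ?_
      rw [iteratedDeriv_cf_zero hX (hmem' j hj), mul_right_comm, mul_div_right_comm,
        ← integral_const_mul]
      refine integral_congr_ae (.of_forall fun ω => ?_)
      push_cast; ring
  have h := integral_re (hexp.sub (integrable_finsetSum _ hpow))
  simp only [RCLike.re_to_complex, Pi.sub_apply] at h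
  rw [hsum, ← h, ← integral_const_mul]
  simp_rw [re_exp_I_mul_sub_sum]

theorem stmt11 {Ω : Type*} [MeasurableSpace Ω] (μ : Measure Ω) [IsProbabilityMeasure μ]
    (p : ℝ) (hp : 0 < p) (hpne : ¬∃ n : ℕ, (2 * n : ℝ) = p)
    (ℓ : ℕ) (hl : ℓ = ⌈p - 1⌉₊)
    (X : Ω → ℝ) (hX : Measurable X)
    (hmom : Integrable (fun ω => |X ω| ^ p) μ) :
    IntegrableOn
      (fun t =>
        (cf μ X t - ∑ j ∈ Finset.range (ℓ + 1),
            iteratedDeriv j (cf μ X) 0 * (t : ℂ) ^ j / (Nat.factorial j)).re / t ^ (p + 1))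
      (Ioi 0) volume ∧
    (∫ ω, |X ω| ^ p ∂μ)
      = -(2 * Real.Gamma (p + 1) / Real.pi) * Real.sin (Real.pi * p / 2)
        * ∫ t in Ioi (0:ℝ),
            (cf μ X t - ∑ j ∈ Finset.range (ℓ + 1),
                iteratedDeriv j (cf μ X) 0 * (t : ℂ) ^ j / (Nat.factorial j)).re / t ^ (p + 1) := by
  have hℓp : (ℓ : ℝ) < p := by
    rcases le_or_gt p 1 with h | h
    · rwa [hl, Nat.ceil_eq_zero.2 (by linarith), Nat.cast_zero]
    · have := Nat.ceil_lt_add_one (show 0 ≤ p - 1 by linarith)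
      rw [hl]; linarith
  have hpℓ : p ≤ ℓ + 1 := by
    have := Nat.le_ceil (p - 1)
    rw [hl]; linarith
  set m := ℓ / 2 with hm
  have hm1 : 2 * (m : ℝ) < p :=
    lt_of_le_of_lt (by exact_mod_cast (by omega : 2 * m ≤ ℓ)) hℓp
  have hm2 : p < 2 * m + 2 := by
    refine lt_of_le_of_ne (hpℓ.trans (by exact_mod_cast (by omega : ℓ + 1 ≤ 2 * m + 2))) ?_
    exact fun h => hpne ⟨m + 1, by rw [h]; push_cast; ring⟩
  have hmem : MemLp X ℓ μ := by
    have h : MemLp X (ENNReal.ofReal p) μ := by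
      rw [← integrable_norm_rpow_iff hX.aestronglyMeasurable (by simpa) (by simp),
        ENNReal.toReal_ofReal hp.le]
      exact hmom
    refine h.mono_exponent ?_
    rw [← ENNReal.ofReal_natCast]
    exact ENNReal.ofReal_le_ofReal hℓp.le
  obtain ⟨hK, hKv⟩ := integrableOn_and_integral_cosRemainder_div_rpow hp hm1 hm2
  set K := ∫ u in Ioi (0 : ℝ), cosRemainder (m + 1) u / u ^ (p + 1)
  have hscale := integrableOn_and_integral_cosRemainder_mul_div_rpow hp hK
  obtain ⟨hB, hBv⟩ := integrable_and_integral_eq_of_nonneg (μ := μ)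
    (ν := volume.restrict (Ioi (0 : ℝ)))
    (F := fun ω t => cosRemainder (m + 1) (t * X ω) / t ^ (p + 1))
    (A := fun ω => |X ω| ^ p * K)
    (B := fun t => (∫ ω, cosRemainder (m + 1) (t * X ω) ∂μ) / t ^ (p + 1))
    (by
      have := (continuous_cosRemainder (m + 1)).measurable
      apply Measurable.aestronglyMeasurable; unfold Function.uncurry; fun_prop)
    (.of_forall fun ω => ae_restrict_of_forall_mem measurableSet_Ioi fun t ht =>
      div_nonneg (cosRemainder_succ_nonneg _ _) (Real.rpow_nonneg (le_of_lt ht) _))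
    (.of_forall fun ω => (hscale (X ω)).1)
    (.of_forall fun ω => (hscale (X ω)).2)
    (hmom.mul_const K)
    (.of_forall fun t => integral_div _ _)
  simp_rw [re_cf_sub_sum hX hmem, ← hm, mul_div_assoc ((-1 : ℝ) ^ (m + 1))]
  refine ⟨hB.const_mul _, ?_⟩
  rw [integral_const_mul, hBv, integral_mul_const, hKv]
  have hG : 0 < Real.Gamma (p + 1) := Real.Gamma_pos_of_pos (by linarith)
  have hsin : Real.sin (Real.pi * p / 2) ≠ 0 := by
    rw [Ne, Real.sin_eq_zero_iff]
    rintro ⟨n, hn⟩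
    have hn' : (2 * n : ℝ) = p := by
      have := Real.pi_pos
      field_simp at hn
      linarith
    have hn0 : 0 ≤ n := by
      have : (0 : ℝ) < n := by linarith
      exact_mod_cast this.le
    lift n to ℕ using hn0
    exact hpne ⟨n, by exact_mod_cast hn'⟩
  have hsign : ((-1 : ℝ) ^ m) * (-1) ^ m = 1 := by rw [← mul_pow]; simp
  have hpi := Real.pi_pos
  rw [pow_succ]
  generalize Real.sin (Real.pi * p / 2) = S at hsin ⊢
  field_simp
  linear_combination -(∫ ω, |X ω| ^ p ∂μ) * hsign
end

section
/- Let p ∈ (0,∞), u ∈ ℝ, and let X be a real random variable with E|X|^p < ∞ and characteristic function f. Let m be an even natural number with m > p, let g_m(t) := (2i·sin t)^m, and let c_p^+(g_m) := lim_{ε↓0, T↑∞} ∫_ε^T g_m(t)/t^{p+1} dt (this limit exists and is nonzero). Then the limit lim_{T↑∞} ∫_0^T (Δ_t^m f)(u)/t^{p+1} dt exists and E[|X|^p·e^{iuX}] = (1/c_p^+(g_m)) · lim_{T↑∞} ∫_0^T (Δ_t^m f)(u)/t^{p+1} dt. -/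
open MeasureTheory Filter Set Topology

/-- `(Δ_v^n ψ)(z)`, the `n`-th symmetric difference of `ψ` with step `v`. -/
noncomputable def deltaPow (n : ℕ) (v : ℝ) (ψ : ℝ → ℂ) (z : ℝ) : ℂ :=
  ∑ j ∈ Finset.range (n + 1), (-1 : ℂ) ^ j * (n.choose j) * ψ (z + ((n : ℝ) - 2 * j) * v)

/-- The kernel `(2 i sin t) ^ m / t ^ (p + 1)`. -/
noncomputable def sinKernel (m : ℕ) (p t : ℝ) : ℂ :=
  (2 * Complex.I * (Real.sin t : ℂ)) ^ m / ((t ^ (p + 1) : ℝ) : ℂ)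

lemma measurable_sinKernel (m : ℕ) (p : ℝ) : Measurable (sinKernel m p) := by
  unfold sinKernel
  fun_prop

lemma norm_sinKernel (m : ℕ) (p : ℝ) {t : ℝ} (ht : 0 < t) :
    ‖sinKernel m p t‖ = (2 * |Real.sin t|) ^ m / t ^ (p + 1) := by
  have := Real.rpow_pos_of_pos ht (p + 1)
  simp [sinKernel, abs_of_pos this, -Complex.ofReal_sin]

lemma integrableOn_sinKernel {m : ℕ} {p : ℝ} (hp : 0 < p) (hmp : p < m) :
    IntegrableOn (sinKernel m p) (Ioi 0) := by
  rw [← Ioc_union_Ioi_eq_Ioi zero_le_one]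
  refine IntegrableOn.union ?_ ?_
  · have h : IntegrableOn (fun t : ℝ => 2 ^ m * t ^ ((m : ℝ) - p - 1)) (Ioc 0 1) := by
      have := intervalIntegral.intervalIntegrable_rpow' (a := 0) (b := 1)
        (r := (m : ℝ) - p - 1) (by linarith)
      rw [intervalIntegrable_iff_integrableOn_Ioc_of_le zero_le_one] at this
      exact this.const_mul _
    refine Integrable.mono' h (measurable_sinKernel m p).aestronglyMeasurable ?_
    filter_upwards [ae_restrict_mem measurableSet_Ioc] with t ht
    have hsin : |Real.sin t| ≤ t := by
      simpa [abs_of_pos ht.1] using Real.abs_sin_le_abs (x := t)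
    rw [norm_sinKernel m p ht.1, show (m : ℝ) - p - 1 = m - (p + 1) by ring,
      Real.rpow_sub ht.1, Real.rpow_natCast, ← mul_div_assoc, ← mul_pow]
    have := Real.rpow_pos_of_pos ht.1 (p + 1)
    gcongr
  · have h : IntegrableOn (fun t : ℝ => 2 ^ m * t ^ (-(p + 1))) (Ioi 1) :=
      (integrableOn_Ioi_rpow_of_lt (by linarith) one_pos).const_mul _
    refine Integrable.mono' h (measurable_sinKernel m p).aestronglyMeasurable ?_
    filter_upwards [ae_restrict_mem measurableSet_Ioi] with t ht
    have ht0 : (0 : ℝ) < t := one_pos.trans ht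
    have := Real.rpow_pos_of_pos ht0 (p + 1)
    rw [norm_sinKernel m p ht0, Real.rpow_neg ht0.le, ← div_eq_mul_inv]
    have h2 : 2 * |Real.sin t| ≤ 2 := by linarith [Real.abs_sin_le_one t]
    gcongr

lemma integral_sinKernel_ne_zero {m : ℕ} {p : ℝ} (hp : 0 < p) (hme : Even m) (hmp : p < m) :
    ∫ t in Ioi 0, sinKernel m p t ≠ 0 := by
  have hint := (integrableOn_sinKernel hp hmp).norm
  have hpos : 0 < ∫ t in Ioi 0, ‖sinKernel m p t‖ := by
    rw [setIntegral_pos_iff_support_of_nonneg_ae (ae_of_all _ fun t => norm_nonneg _) hint]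
    have hsub : Ioo 0 Real.pi ⊆ Function.support (fun t => ‖sinKernel m p t‖) ∩ Ioi 0 := by
      intro t ht
      refine ⟨?_, ht.1⟩
      have h1 := Real.sin_pos_of_pos_of_lt_pi ht.1 ht.2
      have h2 := Real.rpow_pos_of_pos ht.1 (p + 1)
      rw [Function.mem_support, norm_sinKernel m p ht.1]
      positivity
    refine lt_of_lt_of_le ?_ (measure_mono hsub)
    simp [Real.pi_pos]
  have heq : ∫ t in Ioi 0, sinKernel m p t =
      Complex.I ^ m * ((∫ t in Ioi 0, ‖sinKernel m p t‖ : ℝ) : ℂ) := by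
    rw [← integral_complex_ofReal, ← integral_const_mul]
    refine setIntegral_congr_fun measurableSet_Ioi fun t ht => ?_
    simp only [norm_sinKernel m p (mem_Ioi.1 ht), mul_pow, hme.pow_abs]
    simp only [sinKernel]
    push_cast
    ring
  rw [heq]
  exact mul_ne_zero (pow_ne_zero _ Complex.I_ne_zero) (Complex.ofReal_ne_zero.2 hpos.ne')

lemma tendsto_intervalIntegral_nhdsGT_prod_atTop {E : Type*} [NormedAddCommGroup E]
    [NormedSpace ℝ E] {f : ℝ → E} {a : ℝ} (hf : IntegrableOn f (Ioi a)) :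
    Tendsto (fun s : ℝ × ℝ => ∫ t in s.1..s.2, f t) (𝓝[>] a ×ˢ atTop)
      (𝓝 (∫ t in Ioi a, f t)) := by
  have hii : ∀ b, a ≤ b → IntervalIntegrable f volume a b := fun b hb =>
    (intervalIntegrable_iff_integrableOn_Ioc_of_le hb).2 (hf.mono_set Ioc_subset_Ioi_self)
  have h1 : Tendsto (fun T => ∫ t in a..T, f t) atTop (𝓝 (∫ t in Ioi a, f t)) :=
    intervalIntegral_tendsto_integral_Ioi a hf tendsto_id
  have h2 : Tendsto (fun x => ∫ t in a..x, f t) (𝓝[>] a) (𝓝 0) := by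
    have hc : ContinuousOn (fun x => ∫ t in a..x, f t) (Icc a (a + 1)) := by
      have := hii (a + 1) (by linarith)
      rw [intervalIntegrable_iff_integrableOn_Icc_of_le (by linarith)] at this
      rw [← uIcc_of_le (by linarith)] at this ⊢
      exact intervalIntegral.continuousOn_primitive_interval this
    have h := hc a (by simp)
    rw [ContinuousWithinAt, intervalIntegral.integral_same] at h
    refine h.mono_left ?_
    rw [← nhdsWithin_Ioc_eq_nhdsGT (show a < a + 1 by linarith)]
    exact nhdsWithin_mono _ Ioc_subset_Icc_self
  have h3 := (h1.comp tendsto_snd).sub (h2.comp (tendsto_fst (f := 𝓝[>] a) (g := atTop (α := ℝ))))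
  rw [sub_zero] at h3
  refine h3.congr' ?_
  filter_upwards [prod_mem_prod (self_mem_nhdsWithin (a := a) (s := Ioi a)) (Ioi_mem_atTop a)]
    with s hs
  exact intervalIntegral.integral_interval_sub_left (hii _ (le_of_lt hs.2)) (hii _ (le_of_lt hs.1))

/-- The kernel `(2 i sin (t x)) ^ m / t ^ (p + 1)` is a rescaling of `sinKernel`. -/
lemma sin_mul_pow_div_rpow_eq {m : ℕ} (hme : Even m) (p : ℝ) {x t : ℝ} (hx : x ≠ 0)
    (ht : 0 < t) :
    (2 * Complex.I * (Real.sin (t * x) : ℂ)) ^ m / ((t ^ (p + 1) : ℝ) : ℂ) =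
      ((|x| ^ (p + 1) : ℝ) : ℂ) * sinKernel m p (|x| * t) := by
  have hx' := abs_pos.2 hx
  have h1 : Real.sin (t * x) ^ m = Real.sin (|x| * t) ^ m := by
    rcases abs_choice x with h | h <;> rw [h]
    · rw [mul_comm]
    · rw [neg_mul, Real.sin_neg, hme.neg_pow, mul_comm]
  have h2 : ((|x| ^ (p + 1) : ℝ) : ℂ) ≠ 0 :=
    Complex.ofReal_ne_zero.2 (Real.rpow_pos_of_pos hx' _).ne'
  have h3 : ((t ^ (p + 1) : ℝ) : ℂ) ≠ 0 :=
    Complex.ofReal_ne_zero.2 (Real.rpow_pos_of_pos ht _).ne'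
  rw [sinKernel, Real.mul_rpow hx'.le ht.le, mul_pow, mul_pow _ (Complex.ofReal _),
    ← Complex.ofReal_pow, ← Complex.ofReal_pow, h1, Complex.ofReal_mul]
  field_simp

lemma abs_rpow_smul_integral_comp_mul_Ioi {E : Type*} [NormedAddCommGroup E] [NormedSpace ℝ E]
    (f : ℝ → E) (p : ℝ) {x : ℝ} (hx : x ≠ 0) :
    |x| ^ (p + 1) • ∫ t in Ioi 0, f (|x| * t) = |x| ^ p • ∫ t in Ioi 0, f t := by
  have hx' := abs_pos.2 hx
  rw [integral_comp_mul_left_Ioi _ _ hx', mul_zero, smul_smul, Real.rpow_add_one hx'.ne',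
    mul_assoc, mul_inv_cancel₀ hx'.ne', mul_one]

lemma integrableOn_sin_mul_pow_div_rpow {m : ℕ} {p : ℝ} (hp : 0 < p)
    (hme : Even m) (hmp : p < m) (x : ℝ) :
    IntegrableOn (fun t : ℝ =>
      (2 * Complex.I * (Real.sin (t * x) : ℂ)) ^ m / ((t ^ (p + 1) : ℝ) : ℂ)) (Ioi 0) := by
  have hm : m ≠ 0 := by rintro rfl; norm_num at hmp; linarith
  rcases eq_or_ne x 0 with rfl | hx
  · simp [hm]
  · have h := (integrableOn_Ioi_comp_mul_left_iff (sinKernel m p) 0 (abs_pos.2 hx)).2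
      (by simpa using integrableOn_sinKernel hp hmp)
    exact IntegrableOn.congr_fun (h.const_mul ((|x| ^ (p + 1) : ℝ) : ℂ))
      (fun t ht => (sin_mul_pow_div_rpow_eq hme p hx ht).symm) measurableSet_Ioi

lemma integral_sin_mul_pow_div_rpow {m : ℕ} {p : ℝ} (hp : 0 < p)
    (hme : Even m) (hmp : p < m) (x : ℝ) :
    ∫ t in Ioi (0 : ℝ), (2 * Complex.I * (Real.sin (t * x) : ℂ)) ^ m / ((t ^ (p + 1) : ℝ) : ℂ) =
      ((|x| ^ p : ℝ) : ℂ) * ∫ t in Ioi 0, sinKernel m p t := by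
  have hm : m ≠ 0 := by rintro rfl; norm_num at hmp; linarith
  rcases eq_or_ne x 0 with rfl | hx
  · simp [hm, Real.zero_rpow hp.ne']
  · rw [setIntegral_congr_fun measurableSet_Ioi
      fun t ht => sin_mul_pow_div_rpow_eq hme p hx ht, integral_const_mul]
    simpa only [Complex.real_smul] using abs_rpow_smul_integral_comp_mul_Ioi (sinKernel m p) p hx

lemma integral_norm_sin_mul_pow_div_rpow {m : ℕ} {p : ℝ} (hp : 0 < p)
    (hme : Even m) (hmp : p < m) (x : ℝ) :
    ∫ t in Ioi (0 : ℝ),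
        ‖(2 * Complex.I * (Real.sin (t * x) : ℂ)) ^ m / ((t ^ (p + 1) : ℝ) : ℂ)‖ =
      |x| ^ p * ∫ t in Ioi 0, ‖sinKernel m p t‖ := by
  have hm : m ≠ 0 := by rintro rfl; norm_num at hmp; linarith
  rcases eq_or_ne x 0 with rfl | hx
  · simp [hm, Real.zero_rpow hp.ne']
  · rw [setIntegral_congr_fun (g := fun t => |x| ^ (p + 1) * ‖sinKernel m p (|x| * t)‖)
      measurableSet_Ioi, integral_const_mul]
    · simpa only [smul_eq_mul] using
        abs_rpow_smul_integral_comp_mul_Ioi (fun t => ‖sinKernel m p t‖) p hx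
    · intro t ht
      have := Real.rpow_nonneg (abs_nonneg x) (p + 1)
      simp only [sin_mul_pow_div_rpow_eq hme p hx (mem_Ioi.1 ht), norm_mul, Complex.norm_real,
        Real.norm_of_nonneg this]

/-- Binomial expansion of `(2 i sin a) ^ m`. -/
lemma two_I_sin_pow (m : ℕ) (a : ℝ) :
    (2 * Complex.I * (Real.sin a : ℂ)) ^ m =
      ∑ j ∈ Finset.range (m + 1), (-1 : ℂ) ^ j * (m.choose j) *
        Complex.exp (Complex.I * (((m : ℂ) - 2 * j) * a)) := by
  have h : 2 * Complex.I * (Real.sin a : ℂ) =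
      -Complex.exp (-(Complex.I * a)) + Complex.exp (Complex.I * a) := by
    rw [Complex.ofReal_sin, Complex.sin, mul_comm (a : ℂ), neg_mul, mul_comm (a : ℂ)]
    linear_combination (Complex.exp (-(Complex.I * a)) - Complex.exp (Complex.I * a)) *
      Complex.I_mul_I
  rw [h, add_pow]
  refine Finset.sum_congr rfl fun j hj => ?_
  have hj' : j ≤ m := Nat.lt_succ_iff.1 (Finset.mem_range.1 hj)
  have h2 : Complex.exp (Complex.I * (((m : ℂ) - 2 * j) * a)) =
      Complex.exp (-(Complex.I * a)) ^ j * Complex.exp (Complex.I * a) ^ (m - j) := by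
    rw [← Complex.exp_nat_mul, ← Complex.exp_nat_mul, ← Complex.exp_add, Nat.cast_sub hj']
    congr 1
    ring
  rw [h2, neg_pow]
  ring

lemma deltaPow_cf {Ω : Type*} [MeasurableSpace Ω] (μ : Measure Ω) [IsFiniteMeasure μ]
    {X : Ω → ℝ} (hX : Measurable X) (m : ℕ) (t u : ℝ) :
    deltaPow m t (cf μ X) u =
      ∫ ω, Complex.exp (Complex.I * u * X ω) *
        (2 * Complex.I * (Real.sin (t * X ω) : ℂ)) ^ m ∂μ := by
  have hint : ∀ s : ℝ, Integrable (fun ω => Complex.exp (Complex.I * s * X ω)) μ := fun s => by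
    refine Integrable.of_bound (by fun_prop) 1 (ae_of_all _ fun ω => ?_)
    rw [mul_assoc, mul_comm, ← Complex.ofReal_mul, Complex.norm_exp_ofReal_mul_I]
  simp only [deltaPow, cf]
  simp_rw [← integral_const_mul]
  rw [← integral_finsetSum _ fun j _ => (hint _).const_mul _]
  refine integral_congr_ae (ae_of_all _ fun ω => ?_)
  simp only [two_I_sin_pow, Finset.mul_sum]
  refine Finset.sum_congr rfl fun j _ => ?_
  rw [mul_left_comm, ← Complex.exp_add]
  push_cast
  ring_nf

theorem stmt13 {Ω : Type*} [MeasurableSpace Ω] (μ : Measure Ω) [IsProbabilityMeasure μ]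
    (p : ℝ) (hp : 0 < p) (u : ℝ) (X : Ω → ℝ) (hX : Measurable X)
    (hmom : Integrable (fun ω => |X ω| ^ p) μ)
    (m : ℕ) (hme : Even m) (hmp : p < m) :
    ∃ c : ℂ, c ≠ 0 ∧
      Tendsto
        (fun s : ℝ × ℝ =>
          ∫ t in s.1..s.2, (2 * Complex.I * (Real.sin t : ℂ)) ^ m / ((t ^ (p + 1) : ℝ) : ℂ))
        ((𝓝[>] (0:ℝ)) ×ˢ atTop) (𝓝 c) ∧
      ∃ L : ℂ,
        Tendsto
          (fun T => ∫ t in (0:ℝ)..T, deltaPow m t (cf μ X) u / ((t ^ (p + 1) : ℝ) : ℂ))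
          atTop (𝓝 L) ∧
        (∫ ω, ((|X ω| ^ p : ℝ) : ℂ) * Complex.exp (Complex.I * u * X ω) ∂μ) = (1 / c) * L := by
  set c : ℂ := ∫ t in Ioi 0, sinKernel m p t with hc
  have hc0 : c ≠ 0 := integral_sinKernel_ne_zero hp hme hmp
  let F : Ω × ℝ → ℂ := fun z => Complex.exp (Complex.I * u * X z.1) *
    ((2 * Complex.I * (Real.sin (z.2 * X z.1) : ℂ)) ^ m / ((z.2 ^ (p + 1) : ℝ) : ℂ))
  have hFm : Measurable F := by fun_prop
  have hexp : ∀ ω, ‖Complex.exp (Complex.I * u * X ω)‖ = 1 := fun ω => by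
    rw [mul_assoc, mul_comm, ← Complex.ofReal_mul, Complex.norm_exp_ofReal_mul_I]
  have hF : Integrable F (μ.prod (volume.restrict (Ioi 0))) := by
    refine (integrable_prod_iff hFm.aestronglyMeasurable).2 ⟨ae_of_all _ fun ω => ?_, ?_⟩
    · exact (integrableOn_sin_mul_pow_div_rpow hp hme hmp (X ω)).const_mul
        (Complex.exp (Complex.I * u * X ω))
    · simp only [F, norm_mul _ (_ / _), hexp, one_mul,
        integral_norm_sin_mul_pow_div_rpow hp hme hmp]
      exact hmom.mul_const _
  have hΔ : ∀ t : ℝ, deltaPow m t (cf μ X) u / ((t ^ (p + 1) : ℝ) : ℂ) = ∫ ω, F (ω, t) ∂μ := by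
    intro t
    rw [deltaPow_cf μ hX, ← integral_div]
    simp only [F, mul_div_assoc]
  refine ⟨c, hc0, tendsto_intervalIntegral_nhdsGT_prod_atTop (integrableOn_sinKernel hp hmp),
    ∫ t in Ioi (0 : ℝ), ∫ ω, F (ω, t) ∂μ, ?_, ?_⟩
  · simp only [hΔ]
    exact intervalIntegral_tendsto_integral_Ioi 0 hF.integral_prod_right tendsto_id
  · rw [← integral_integral_swap (f := fun ω t => F (ω, t)) hF]
    simp only [F, integral_const_mul, integral_sin_mul_pow_div_rpow hp hme hmp, ← hc]
    rw [← integral_const_mul]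
    refine integral_congr_ae (ae_of_all _ fun ω => ?_)
    field_simp
end

section
/- (Truncated moments in terms of the characteristic function.) Let m ∈ {0,1,2,...}, let r and x be real, and let X be a real random variable with E|X|^r < ∞ (and P(X = 0) = 0 if r < 0). For t ∈ ℝ set F_r(t) := i^r · E[conj(X^r)·e^{itX}] and F_{r,x}(t) := e^{−itx}·F_r(t). Then the limit lim_{ε↓0, T↑∞} ∫_ε^T (Δ_t^{2m+1} F_{r,x})(0)/t dt exists and E[conj(X^r)·𝟙{X < x}] + (1/2)·E[conj(X^r)·𝟙{X = x}] = F_r(0)/(2·i^r) − ( (−1)^m/(2π·i^{r+1}·C(2m,m)) ) · lim_{ε↓0, T↑∞} ∫_ε^T (Δ_t^{2m+1} F_{r,x})(0)/t dt. -/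
open MeasureTheory Filter Set Topology
open scoped Classical

/-- Principal complex power of a real number, with the convention `0 ^ s = 0`. -/
noncomputable def rcpow (x s : ℝ) : ℂ := if x = 0 then 0 else (x : ℂ) ^ (s : ℂ)

/-- `F s w = iˢ · E[conj(Xˢ)·e^{iwX}]`, the fractional derivative of order `s` of the
characteristic function of `X`, evaluated at `w`. -/
noncomputable def fracDeriv {Ω : Type*} [MeasurableSpace Ω] (μ : Measure Ω) (X : Ω → ℝ)
    (s w : ℝ) : ℂ :=
  Complex.I ^ (s : ℂ) *
    ∫ ω, (starRingEnd ℂ) (rcpow (X ω) s) * Complex.exp (Complex.I * w * X ω) ∂μ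

/-- The sine integral `Si z = ∫₀ᶻ sin t / t dt`. -/
noncomputable def sinIntegral (z : ℝ) : ℝ := ∫ t in (0 : ℝ)..z, Real.sinc t

theorem continuous_sinIntegral : Continuous sinIntegral :=
  intervalIntegral.continuous_primitive (fun _ _ => Real.continuous_sinc.intervalIntegrable _ _) 0

theorem sinIntegral_zero : sinIntegral 0 = 0 := by simp [sinIntegral]

theorem sinIntegral_neg (z : ℝ) : sinIntegral (-z) = -sinIntegral z := by
  have h := intervalIntegral.integral_comp_neg (a := 0) (b := z) Real.sinc
  simp only [Real.sinc_neg, neg_zero] at h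
  rw [sinIntegral, intervalIntegral.integral_symm, ← h, sinIntegral]

theorem integral_sin_mul_exp_neg_mul (T p : ℝ) :
    ∫ t in (0 : ℝ)..T, Real.sin t * Real.exp (-t * p)
      = (1 - Real.exp (-p * T) * (Real.cos T + p * Real.sin T)) * (1 + p ^ 2)⁻¹ := by
  have hp : (1 + p ^ 2) ≠ 0 := by positivity
  have hderiv : ∀ t ∈ uIcc 0 T, HasDerivAt
      (fun t => -(Real.exp (-p * t) * (Real.cos t + p * Real.sin t)) * (1 + p ^ 2)⁻¹)
      (Real.sin t * Real.exp (-t * p)) t := by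
    intro t _
    have h1 : HasDerivAt (fun t => Real.exp (-p * t)) (Real.exp (-p * t) * (-p * 1)) t :=
      ((hasDerivAt_id t).const_mul (-p)).exp
    have h2 := (Real.hasDerivAt_cos t).add ((Real.hasDerivAt_sin t).const_mul p)
    refine ((h1.mul h2).neg.mul_const _).congr_deriv ?_
    have : -t * p = -p * t := by ring
    rw [this]
    simp only [Pi.add_apply]
    field_simp
    ring
  rw [intervalIntegral.integral_eq_sub_of_hasDerivAt hderiv
    (Continuous.intervalIntegrable (by fun_prop) _ _)]
  simp
  ring

theorem integrable_sin_mul_exp_neg_mul_prod (T : ℝ) :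
    Integrable (Function.uncurry fun t p : ℝ => Real.sin t * Real.exp (-t * p))
      ((volume.restrict (Ioc 0 T)).prod (volume.restrict (Ioi 0))) := by
  rw [integrable_prod_iff (Continuous.aestronglyMeasurable (by fun_prop))]
  constructor
  · filter_upwards [ae_restrict_mem measurableSet_Ioc] with t ht
    simp only [Function.uncurry_apply_pair]
    exact (exp_neg_integrableOn_Ioi 0 ht.1).const_mul _
  · refine Integrable.congr (f := fun t => |Real.sinc t|) ?_ ?_
    · exact (Real.continuous_sinc.abs.integrableOn_Icc (a := 0) (b := T)).mono_set
        Ioc_subset_Icc_self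
    · filter_upwards [ae_restrict_mem measurableSet_Ioc] with t ht
      simp only [Function.uncurry_apply_pair, norm_mul, Real.norm_eq_abs, Real.abs_exp]
      rw [integral_const_mul, integral_exp_mul_Ioi (neg_lt_zero.2 ht.1),
        Real.sinc_of_ne_zero ht.1.ne', abs_div, abs_of_pos ht.1]
      simp [div_eq_mul_inv]

theorem sinIntegral_eq_integral_Ioi {T : ℝ} (hT : 0 ≤ T) :
    sinIntegral T = ∫ p in Ioi (0 : ℝ),
      (1 - Real.exp (-p * T) * (Real.cos T + p * Real.sin T)) * (1 + p ^ 2)⁻¹ := by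
  have h := integral_integral_swap (integrable_sin_mul_exp_neg_mul_prod T)
  simp_rw [← intervalIntegral.integral_of_le hT, integral_sin_mul_exp_neg_mul] at h
  rw [← h, sinIntegral, intervalIntegral.integral_of_le hT, intervalIntegral.integral_of_le hT]
  refine setIntegral_congr_fun measurableSet_Ioc fun t ht => ?_
  rw [integral_const_mul, integral_exp_mul_Ioi (neg_lt_zero.2 ht.1),
    Real.sinc_of_ne_zero ht.1.ne']
  simp [div_eq_mul_inv]

theorem norm_sinIntegral_integrand_le {T p : ℝ} (hT : 0 ≤ T) (hp : 0 < p) :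
    ‖(1 - Real.exp (-p * T) * (Real.cos T + p * Real.sin T)) * (1 + p ^ 2)⁻¹‖
      ≤ 2 * (1 + p ^ 2)⁻¹ := by
  have hinv : 0 ≤ (1 + p ^ 2)⁻¹ := by positivity
  rw [norm_mul, Real.norm_of_nonneg hinv]
  refine mul_le_mul_of_nonneg_right ?_ hinv
  have hs : |Real.sin T| ≤ T := by simpa [abs_of_nonneg hT] using Real.abs_sin_le_abs (x := T)
  have h1 : |Real.cos T + p * Real.sin T| ≤ 1 + p * T := by
    refine (abs_add_le _ _).trans (add_le_add (Real.abs_cos_le_one T) ?_)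
    rw [abs_mul, abs_of_pos hp]
    exact mul_le_mul_of_nonneg_left hs hp.le
  have h2 : |Real.exp (-p * T) * (Real.cos T + p * Real.sin T)| ≤ 1 := by
    rw [abs_mul, Real.abs_exp]
    calc _ ≤ Real.exp (-p * T) * Real.exp (p * T) := by
          gcongr
          linarith [Real.add_one_le_exp (p * T)]
      _ = 1 := by rw [← Real.exp_add]; simp
  calc _ ≤ ‖(1 : ℝ)‖ + ‖Real.exp (-p * T) * (Real.cos T + p * Real.sin T)‖ := norm_sub_le _ _
    _ ≤ 2 := by rw [Real.norm_eq_abs (_ * _), norm_one]; linarith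

theorem abs_sinIntegral_le (z : ℝ) : |sinIntegral z| ≤ Real.pi := by
  have key : ∀ T, 0 ≤ T → |sinIntegral T| ≤ Real.pi := by
    intro T hT
    rw [sinIntegral_eq_integral_Ioi hT, ← Real.norm_eq_abs]
    refine (norm_integral_le_of_norm_le (integrable_inv_one_add_sq.integrableOn.const_mul 2)
      ?_).trans_eq ?_
    · filter_upwards [ae_restrict_mem measurableSet_Ioi] with p hp
      exact norm_sinIntegral_integrand_le hT hp
    · rw [integral_const_mul, integral_Ioi_inv_one_add_sq, Real.arctan_zero]
      ring
  rcases le_total 0 z with h | h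
  · exact key z h
  · simpa [sinIntegral_neg] using key (-z) (neg_nonneg.2 h)

/-- The Dirichlet integral. -/
theorem tendsto_sinIntegral_atTop : Tendsto sinIntegral atTop (𝓝 (Real.pi / 2)) := by
  have h : Tendsto (fun T => ∫ p in Ioi (0 : ℝ),
      (1 - Real.exp (-p * T) * (Real.cos T + p * Real.sin T)) * (1 + p ^ 2)⁻¹) atTop
      (𝓝 (∫ p in Ioi (0 : ℝ), (1 + p ^ 2)⁻¹)) := by
    refine tendsto_integral_filter_of_dominated_convergence (fun p => 2 * (1 + p ^ 2)⁻¹) ?_ ?_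
      (integrable_inv_one_add_sq.integrableOn.const_mul 2) ?_
    · exact Eventually.of_forall fun T => Measurable.aestronglyMeasurable (by fun_prop)
    · filter_upwards [eventually_ge_atTop 0] with T hT
      filter_upwards [ae_restrict_mem measurableSet_Ioi] with p hp
      exact norm_sinIntegral_integrand_le hT hp
    · filter_upwards [ae_restrict_mem measurableSet_Ioi] with p hp
      have hexp : Tendsto (fun T => Real.exp (-p * T)) atTop (𝓝 0) :=
        Real.tendsto_exp_atBot.comp
          (tendsto_id.const_mul_atTop_of_neg (neg_lt_zero.2 hp))
      have hbdd : IsBoundedUnder (· ≤ ·) atTop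
          (norm ∘ fun T => Real.cos T + p * Real.sin T) := by
        refine isBoundedUnder_of ⟨1 + |p|, fun T => ?_⟩
        refine (norm_add_le _ _).trans (add_le_add (Real.abs_cos_le_one T) ?_)
        rw [norm_mul]
        exact mul_le_of_le_one_right (abs_nonneg p) (Real.abs_sin_le_one T)
      simpa using ((hexp.zero_mul_isBoundedUnder_le hbdd).const_sub 1).mul_const (1 + p ^ 2)⁻¹
  rw [integral_Ioi_inv_one_add_sq, Real.arctan_zero, sub_zero] at h
  refine h.congr' ?_
  filter_upwards [eventually_ge_atTop 0] with T hT using (sinIntegral_eq_integral_Ioi hT).symm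

theorem tendsto_sinIntegral_const_mul_atTop (k : ℝ) :
    Tendsto (fun T => sinIntegral (k * T)) atTop (𝓝 (Real.sign k * (Real.pi / 2))) := by
  rcases lt_trichotomy k 0 with h | rfl | h
  · have := (tendsto_sinIntegral_atTop.comp
      (tendsto_id.const_mul_atTop (neg_pos.2 h))).neg
    rw [Real.sign_of_neg h, neg_one_mul]
    refine this.congr fun T => ?_
    simp [sinIntegral_neg]
  · simp [sinIntegral_zero]
  · rw [Real.sign_of_pos h, one_mul]
    exact tendsto_sinIntegral_atTop.comp (tendsto_id.const_mul_atTop h)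

theorem integral_sin_mul_div {a b : ℝ} (ha : 0 < a) (hb : 0 < b) (k : ℝ) :
    ∫ t in a..b, Real.sin (k * t) / t = sinIntegral (k * b) - sinIntegral (k * a) := by
  have hi : ∀ u v, IntervalIntegrable Real.sinc volume u v := fun u v =>
    Real.continuous_sinc.intervalIntegrable _ _
  rw [sinIntegral, sinIntegral, intervalIntegral.integral_interval_sub_left (hi _ _) (hi _ _),
    ← intervalIntegral.mul_integral_comp_mul_left, ← intervalIntegral.integral_const_mul]
  refine intervalIntegral.integral_congr fun t ht => ?_
  have ht0 : t ≠ 0 := (lt_of_lt_of_le (lt_min ha hb) ht.1).ne'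
  rcases eq_or_ne k 0 with rfl | hk
  · simp
  · simp only [Real.sinc_of_ne_zero (mul_ne_zero hk ht0)]
    field_simp

/-- The sine sum `∑ⱼ (-1)ʲ C(n,j) sin ((n - 2j) u)`, equal to `2ⁿ (-1)ᵐ sinⁿ u` for `n = 2m + 1`. -/
noncomputable def symmSin (n : ℕ) (u : ℝ) : ℝ :=
  ∑ j ∈ Finset.range (n + 1), (-1 : ℝ) ^ j * n.choose j * Real.sin (((n : ℝ) - 2 * j) * u)

theorem continuous_symmSin (n : ℕ) : Continuous (symmSin n) := by
  unfold symmSin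
  fun_prop

theorem abs_symmSin_le (n : ℕ) (u : ℝ) : |symmSin n u| ≤ 2 ^ n := by
  have hn : (2 : ℝ) ^ n = ∑ j ∈ Finset.range (n + 1), (n.choose j : ℝ) := by
    exact_mod_cast (Nat.sum_range_choose n).symm
  rw [symmSin, hn]
  refine (Finset.abs_sum_le_sum_abs _ _).trans (Finset.sum_le_sum fun j _ => ?_)
  rw [abs_mul, abs_mul, abs_pow, abs_neg, abs_one, one_pow, one_mul, Nat.abs_cast]
  exact mul_le_of_le_one_right (Nat.cast_nonneg _) (Real.abs_sin_le_one _)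

theorem Odd.sum_flip_eq_neg {n : ℕ} (hn : Odd n) (g : ℝ → ℝ) :
    ∑ j ∈ Finset.range (n + 1), (-1 : ℝ) ^ j * n.choose j * g (-((n : ℝ) - 2 * j))
      = -∑ j ∈ Finset.range (n + 1), (-1 : ℝ) ^ j * n.choose j * g ((n : ℝ) - 2 * j) := by
  rw [← Finset.sum_flip, ← Finset.sum_neg_distrib]
  refine Finset.sum_congr rfl fun j hj => ?_
  have hj' : j ≤ n := Nat.lt_succ_iff.1 (Finset.mem_range.1 hj)
  have hsign : (-1 : ℝ) ^ (n - j) = -(-1) ^ j := by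
    have h1 : (-1 : ℝ) ^ (n - j) * (-1) ^ j = -1 := by
      rw [← pow_add, Nat.sub_add_cancel hj', hn.neg_one_pow]
    have h2 : ((-1 : ℝ) ^ j) * (-1) ^ j = 1 := by rw [← mul_pow]; simp
    linear_combination (-1) ^ j * h1 - (-1 : ℝ) ^ (n - j) * h2
  rw [hsign, Nat.choose_symm hj', Nat.cast_sub hj']
  have : -((n : ℝ) - 2 * ((n : ℝ) - j)) = n - 2 * j := by ring
  rw [this]
  ring

theorem Odd.sum_choose_mul_exp {n : ℕ} (hn : Odd n) (u : ℝ) :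
    ∑ j ∈ Finset.range (n + 1),
        (-1 : ℂ) ^ j * n.choose j * Complex.exp (Complex.I * ((((n : ℝ) - 2 * j) * u : ℝ) : ℂ))
      = Complex.I * symmSin n u := by
  have hcos : ∑ j ∈ Finset.range (n + 1),
      (-1 : ℝ) ^ j * n.choose j * Real.cos (((n : ℝ) - 2 * j) * u) = 0 := by
    have h := hn.sum_flip_eq_neg fun k => Real.cos (k * u)
    simp only [neg_mul, Real.cos_neg] at h
    linarith
  have hterm : ∀ j ∈ Finset.range (n + 1),
      (-1 : ℂ) ^ j * n.choose j * Complex.exp (Complex.I * ((((n : ℝ) - 2 * j) * u : ℝ) : ℂ))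
      = (((-1 : ℝ) ^ j * n.choose j * Real.cos (((n : ℝ) - 2 * j) * u) : ℝ) : ℂ)
        + Complex.I * (((-1 : ℝ) ^ j * n.choose j * Real.sin (((n : ℝ) - 2 * j) * u) : ℝ) : ℂ) := by
    intro j _
    rw [mul_comm Complex.I, Complex.exp_mul_I, ← Complex.ofReal_cos, ← Complex.ofReal_sin]
    push_cast
    ring
  rw [Finset.sum_congr rfl hterm, Finset.sum_add_distrib, ← Finset.mul_sum, ← Complex.ofReal_sum,
    ← Complex.ofReal_sum, hcos, symmSin]
  simp

theorem sum_choose_mul_sign (m : ℕ) :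
    ∑ j ∈ Finset.range (2 * m + 1 + 1), (-1 : ℝ) ^ j * (2 * m + 1).choose j *
        Real.sign (((2 * m + 1 : ℕ) : ℝ) - 2 * j)
      = 2 * ((-1) ^ m * (2 * m).choose m) := by
  have hodd : Odd (2 * m + 1) := ⟨m, rfl⟩
  set P : ℕ → ℝ := fun j => (-1 : ℝ) ^ j * (2 * m + 1).choose j with hP
  have hsum : ∑ j ∈ Finset.range (m + 1), P j = (-1) ^ m * (2 * m).choose m := by
    have h := congrArg (Int.cast : ℤ → ℝ)
      (Int.alternating_sum_range_choose_eq_choose (n := 2 * m) (m := m))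
    push_cast at h
    exact h
  have htot : ∑ j ∈ Finset.range (2 * m + 1 + 1), P j = 0 := by
    have h := congrArg (Int.cast : ℤ → ℝ)
      (Int.alternating_sum_range_choose_of_ne (n := 2 * m + 1) (by omega))
    push_cast at h
    exact h
  have hsplit : 2 * m + 1 + 1 = (m + 1) + (m + 1) := by ring
  rw [hsplit, Finset.sum_range_add] at htot ⊢
  have hpos : ∀ j ∈ Finset.range (m + 1),
      P j * Real.sign (((2 * m + 1 : ℕ) : ℝ) - 2 * j) = P j := by
    intro j hj
    have hj' : (j : ℝ) ≤ m := by exact_mod_cast Nat.lt_succ_iff.1 (Finset.mem_range.1 hj)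
    rw [Real.sign_of_pos (by push_cast; linarith), mul_one]
  have hneg : ∀ j ∈ Finset.range (m + 1),
      P (m + 1 + j) * Real.sign (((2 * m + 1 : ℕ) : ℝ) - 2 * ((m + 1 + j : ℕ) : ℝ))
        = -P (m + 1 + j) := by
    intro j _
    have hj' : (0 : ℝ) ≤ j := Nat.cast_nonneg j
    rw [Real.sign_of_neg (by push_cast; linarith), mul_neg_one]
  rw [Finset.sum_congr rfl hpos, Finset.sum_congr rfl hneg, Finset.sum_neg_distrib]
  linarith

theorem Real.sign_mul (a b : ℝ) : Real.sign (a * b) = Real.sign a * Real.sign b := by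
  rcases lt_trichotomy a 0 with ha | rfl | ha <;> rcases lt_trichotomy b 0 with hb | rfl | hb <;>
    simp [Real.sign_of_neg, Real.sign_of_pos, mul_pos_of_neg_of_neg, mul_neg_of_neg_of_pos,
      mul_neg_of_pos_of_neg, *]

theorem integral_symmSin_mul_div (n : ℕ) {a b : ℝ} (ha : 0 < a) (hb : 0 < b) (y : ℝ) :
    ∫ t in a..b, symmSin n (y * t) / t
      = ∑ j ∈ Finset.range (n + 1), (-1 : ℝ) ^ j * n.choose j *
          (sinIntegral (((n : ℝ) - 2 * j) * y * b) - sinIntegral (((n : ℝ) - 2 * j) * y * a)) := by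
  have hne : ∀ t ∈ uIcc a b, t ≠ 0 := fun t ht => (lt_of_lt_of_le (lt_min ha hb) ht.1).ne'
  have hint : ∀ k : ℝ, IntervalIntegrable (fun t => Real.sin (k * t) / t) volume a b := fun k =>
    ContinuousOn.intervalIntegrable
      (ContinuousOn.div (by fun_prop) continuousOn_id hne)
  simp_rw [← integral_sin_mul_div ha hb, ← intervalIntegral.integral_const_mul]
  rw [← intervalIntegral.integral_finsetSum fun j _ => (hint _).const_mul _]
  refine intervalIntegral.integral_congr fun t _ => ?_
  simp only [symmSin, Finset.sum_div]
  refine Finset.sum_congr rfl fun j _ => ?_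
  rw [mul_assoc (_ - _) y t, mul_div_assoc]

theorem abs_integral_symmSin_mul_div_le (n : ℕ) {a b : ℝ} (ha : 0 < a) (hb : 0 < b) (y : ℝ) :
    |∫ t in a..b, symmSin n (y * t) / t| ≤ 2 ^ n * (2 * Real.pi) := by
  have hn : (2 : ℝ) ^ n = ∑ j ∈ Finset.range (n + 1), (n.choose j : ℝ) := by
    exact_mod_cast (Nat.sum_range_choose n).symm
  rw [integral_symmSin_mul_div n ha hb, hn, Finset.sum_mul]
  refine (Finset.abs_sum_le_sum_abs _ _).trans (Finset.sum_le_sum fun j _ => ?_)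
  rw [abs_mul, abs_mul, abs_pow, abs_neg, abs_one, one_pow, one_mul, Nat.abs_cast]
  refine mul_le_mul_of_nonneg_left ((abs_sub _ _).trans ?_) (Nat.cast_nonneg _)
  exact (add_le_add (abs_sinIntegral_le _) (abs_sinIntegral_le _)).trans_eq (two_mul _).symm

theorem tendsto_integral_symmSin_mul_div (m : ℕ) (y : ℝ) :
    Tendsto (fun s : ℝ × ℝ => ∫ t in s.1..s.2, symmSin (2 * m + 1) (y * t) / t)
      ((𝓝[>] (0 : ℝ)) ×ˢ atTop)
      (𝓝 (Real.pi * ((-1) ^ m * (2 * m).choose m) * Real.sign y)) := by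
  have hterm : ∀ k : ℝ, Tendsto
      (fun s : ℝ × ℝ => sinIntegral (k * y * s.2) - sinIntegral (k * y * s.1))
      ((𝓝[>] (0 : ℝ)) ×ˢ atTop) (𝓝 (Real.sign (k * y) * (Real.pi / 2) - 0)) := by
    intro k
    refine ((tendsto_sinIntegral_const_mul_atTop _).comp tendsto_snd).sub ?_
    have h0 : Tendsto (fun a => sinIntegral (k * y * a)) (𝓝[>] 0) (𝓝 0) := by
      have hc : Continuous fun a => sinIntegral (k * y * a) :=
        continuous_sinIntegral.comp (continuous_const_mul _)
      have := hc.tendsto 0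
      rw [mul_zero, sinIntegral_zero] at this
      exact this.mono_left nhdsWithin_le_nhds
    exact h0.comp tendsto_fst
  have hlim := tendsto_finsetSum (Finset.range (2 * m + 1 + 1)) fun j _ =>
    (hterm (((2 * m + 1 : ℕ) : ℝ) - 2 * j)).const_mul
      ((-1 : ℝ) ^ j * (2 * m + 1).choose j)
  have hval : ∑ j ∈ Finset.range (2 * m + 1 + 1), (-1 : ℝ) ^ j * (2 * m + 1).choose j *
      (Real.sign ((((2 * m + 1 : ℕ) : ℝ) - 2 * j) * y) * (Real.pi / 2) - 0)
      = Real.pi * ((-1) ^ m * (2 * m).choose m) * Real.sign y := by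
    have hfac : Real.pi * ((-1) ^ m * (2 * m).choose m) * Real.sign y
        = 2 * ((-1) ^ m * (2 * m).choose m) * (Real.sign y * (Real.pi / 2)) := by ring
    rw [hfac, ← sum_choose_mul_sign, Finset.sum_mul]
    refine Finset.sum_congr rfl fun j _ => ?_
    rw [Real.sign_mul]
    ring
  rw [hval] at hlim
  refine hlim.congr' ?_
  have h1 : ∀ᶠ s : ℝ × ℝ in (𝓝[>] (0 : ℝ)) ×ˢ atTop, 0 < s.1 :=
    tendsto_fst.eventually self_mem_nhdsWithin
  have h2 : ∀ᶠ s : ℝ × ℝ in (𝓝[>] (0 : ℝ)) ×ˢ atTop, 0 < s.2 :=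
    tendsto_snd.eventually (eventually_gt_atTop 0)
  filter_upwards [h1, h2] with s hs1 hs2 using (integral_symmSin_mul_div _ hs1 hs2 y).symm

theorem measurable_sign : Measurable Real.sign := by
  unfold Real.sign
  exact Measurable.ite measurableSet_Iio measurable_const
    (Measurable.ite measurableSet_Ioi measurable_const measurable_const)

theorem measurable_rcpow (s : ℝ) : Measurable fun x => rcpow x s := by
  unfold rcpow
  exact Measurable.ite (measurableSet_singleton 0) measurable_const
    (Complex.measurable_ofReal.pow_const _)

theorem norm_rcpow_le (x s : ℝ) : ‖rcpow x s‖ ≤ |x| ^ s := by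
  unfold rcpow
  split_ifs
  · simpa using Real.rpow_nonneg (abs_nonneg x) s
  · rw [Complex.norm_cpow_real, Complex.norm_real, Real.norm_eq_abs]

theorem integrable_conj_rcpow {Ω : Type*} [MeasurableSpace Ω] {μ : Measure Ω} {r : ℝ} {X : Ω → ℝ}
    (hX : Measurable X) (hmom : Integrable (fun ω => |X ω| ^ r) μ) :
    Integrable (fun ω => (starRingEnd ℂ) (rcpow (X ω) r)) μ := by
  refine hmom.mono' (Measurable.aestronglyMeasurable
    (Complex.continuous_conj.measurable.comp ((measurable_rcpow r).comp hX)))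
    (Eventually.of_forall fun ω => ?_)
  rw [RCLike.norm_conj]
  exact norm_rcpow_le _ _

theorem deltaPow_exp_mul_fracDeriv_div {Ω : Type*} [MeasurableSpace Ω] {μ : Measure Ω} {n : ℕ}
    (hn : Odd n) {r x : ℝ} {X : Ω → ℝ} (hX : Measurable X)
    (hc : Integrable (fun ω => (starRingEnd ℂ) (rcpow (X ω) r)) μ) (t : ℝ) :
    deltaPow n t (fun w => Complex.exp (-(Complex.I * w * x)) * fracDeriv μ X r w) 0 / (t : ℂ)
      = Complex.I ^ (r : ℂ) * Complex.I * ∫ ω, (starRingEnd ℂ) (rcpow (X ω) r) *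
          ((symmSin n ((X ω - x) * t) / t : ℝ) : ℂ) ∂μ := by
  have hint : ∀ w : ℝ, Integrable (fun ω => (starRingEnd ℂ) (rcpow (X ω) r) *
      Complex.exp (Complex.I * ((w * ((X ω - x) * t) : ℝ) : ℂ))) μ := fun w => by
    refine hc.mul_bdd (c := 1) (Measurable.aestronglyMeasurable (by fun_prop))
      (Eventually.of_forall fun ω => ?_)
    rw [mul_comm Complex.I, Complex.norm_exp_ofReal_mul_I]
  have hterm : ∀ j ∈ Finset.range (n + 1), (-1 : ℂ) ^ j * (n.choose j) *
      (Complex.exp (-(Complex.I * ((0 + ((n : ℝ) - 2 * j) * t : ℝ) : ℂ) * x)) *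
        fracDeriv μ X r (0 + ((n : ℝ) - 2 * j) * t))
      = Complex.I ^ (r : ℂ) * ∫ ω, (starRingEnd ℂ) (rcpow (X ω) r) * ((-1 : ℂ) ^ j * n.choose j *
          Complex.exp (Complex.I * ((((n : ℝ) - 2 * j) * ((X ω - x) * t) : ℝ) : ℂ))) ∂μ := by
    intro j _
    rw [fracDeriv, mul_left_comm (Complex.exp _), ← integral_const_mul, mul_left_comm,
      ← integral_const_mul]
    congr 2 with ω
    have hexp : Complex.exp (Complex.I * ((((n : ℝ) - 2 * j) * ((X ω - x) * t) : ℝ) : ℂ))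
        = Complex.exp (-(Complex.I * ((0 + ((n : ℝ) - 2 * j) * t : ℝ) : ℂ) * x)) *
          Complex.exp (Complex.I * ((0 + ((n : ℝ) - 2 * j) * t : ℝ) : ℂ) * X ω) := by
      rw [← Complex.exp_add]
      congr 1
      push_cast
      ring
    rw [hexp]
    ring
  rw [deltaPow, Finset.sum_congr rfl hterm, ← Finset.mul_sum, ← integral_finsetSum]
  · rw [mul_div_assoc, mul_assoc, ← integral_div, ← integral_const_mul Complex.I]
    congr 2 with ω
    rw [← Finset.mul_sum, hn.sum_choose_mul_exp]
    push_cast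
    ring
  · intro j _
    refine ((hint ((n : ℝ) - 2 * j)).const_mul ((-1 : ℂ) ^ j * n.choose j)).congr
      (Eventually.of_forall fun ω => ?_)
    ring

theorem integral_integral_symmSin {Ω : Type*} [MeasurableSpace Ω] {μ : Measure Ω} [SFinite μ]
    (n : ℕ) {c : Ω → ℂ} (hc : Integrable c μ) {y : Ω → ℝ} (hy : Measurable y) {a b : ℝ}
    (ha : 0 < a) (hb : 0 < b) :
    ∫ t in a..b, ∫ ω, c ω * ((symmSin n (y ω * t) / t : ℝ) : ℂ) ∂μ
      = ∫ ω, c ω * ((∫ t in a..b, symmSin n (y ω * t) / t : ℝ) : ℂ) ∂μ := by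
  rw [intervalIntegral_integral_swap]
  · simp_rw [intervalIntegral.integral_const_mul, intervalIntegral.integral_ofReal]
  · have hmeas : Measurable fun p : ℝ × Ω => ((symmSin n (y p.2 * p.1) / p.1 : ℝ) : ℂ) :=
      Complex.measurable_ofReal.comp (((continuous_symmSin n).measurable.comp
        ((hy.comp measurable_snd).mul measurable_fst)).div measurable_fst)
    have : IsFiniteMeasure (volume.restrict (uIoc a b)) :=
      ⟨by rw [Measure.restrict_apply_univ]; simp [uIoc]⟩
    refine (hc.comp_snd (volume.restrict (uIoc a b))).mul_bdd (c := 2 ^ n / min a b)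
      hmeas.aestronglyMeasurable ?_
    have hmem : ∀ᵐ p : ℝ × Ω ∂(volume.restrict (uIoc a b)).prod μ, p.1 ∈ uIoc a b :=
      Measure.quasiMeasurePreserving_fst.ae (ae_restrict_mem measurableSet_uIoc)
    filter_upwards [hmem] with p hp
    have hmin : 0 < min a b := lt_min ha hb
    rw [Complex.norm_real, Real.norm_eq_abs, abs_div]
    exact div_le_div₀ (by positivity) (abs_symmSin_le _ _) hmin (hp.1.le.trans (le_abs_self _))

theorem tendsto_integral_integral_symmSin {Ω : Type*} [MeasurableSpace Ω] {μ : Measure Ω}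
    [SFinite μ] (m : ℕ) {c : Ω → ℂ} (hc : Integrable c μ) {y : Ω → ℝ} (hy : Measurable y) :
    Tendsto (fun s : ℝ × ℝ => ∫ t in s.1..s.2, ∫ ω,
        c ω * ((symmSin (2 * m + 1) (y ω * t) / t : ℝ) : ℂ) ∂μ)
      ((𝓝[>] (0 : ℝ)) ×ˢ atTop)
      (𝓝 (∫ ω, c ω *
        ((Real.pi * ((-1) ^ m * (2 * m).choose m) * Real.sign (y ω) : ℝ) : ℂ) ∂μ)) := by
  have h1 : ∀ᶠ s : ℝ × ℝ in (𝓝[>] (0 : ℝ)) ×ˢ atTop, 0 < s.1 :=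
    tendsto_fst.eventually self_mem_nhdsWithin
  have h2 : ∀ᶠ s : ℝ × ℝ in (𝓝[>] (0 : ℝ)) ×ˢ atTop, 0 < s.2 :=
    tendsto_snd.eventually (eventually_gt_atTop 0)
  refine Tendsto.congr' (f₁ := fun s => ∫ ω, c ω *
    ((∫ t in s.1..s.2, symmSin (2 * m + 1) (y ω * t) / t : ℝ) : ℂ) ∂μ) ?_ ?_
  · filter_upwards [h1, h2] with s hs1 hs2
    exact (integral_integral_symmSin _ hc hy hs1 hs2).symm
  refine tendsto_integral_filter_of_dominated_convergence
    (fun ω => ‖c ω‖ * (2 ^ (2 * m + 1) * (2 * Real.pi))) ?_ ?_ (hc.norm.mul_const _) ?_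
  · filter_upwards [h1, h2] with s hs1 hs2
    refine hc.aestronglyMeasurable.mul (Measurable.aestronglyMeasurable ?_)
    simp_rw [integral_symmSin_mul_div _ hs1 hs2]
    have hSi : Measurable sinIntegral := continuous_sinIntegral.measurable
    fun_prop
  · filter_upwards [h1, h2] with s hs1 hs2
    refine Eventually.of_forall fun ω => ?_
    rw [norm_mul, Complex.norm_real]
    exact mul_le_mul_of_nonneg_left (abs_integral_symmSin_mul_div_le _ hs1 hs2 _) (norm_nonneg _)
  · refine Eventually.of_forall fun ω => ?_
    exact ((Complex.continuous_ofReal.tendsto _).comp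
      (tendsto_integral_symmSin_mul_div m (y ω))).const_mul _

theorem stmt15 {Ω : Type*} [MeasurableSpace Ω] (μ : Measure Ω) [IsProbabilityMeasure μ]
    (m : ℕ) (r x : ℝ) (X : Ω → ℝ) (hX : Measurable X)
    (hmom : Integrable (fun ω => |X ω| ^ r) μ)
    (h0 : r < 0 → μ {ω | X ω = 0} = 0) :
    ∃ L : ℂ,
      Tendsto
        (fun s : ℝ × ℝ =>
          ∫ t in s.1..s.2,
            deltaPow (2 * m + 1) t
              (fun w => Complex.exp (-(Complex.I * w * x)) * fracDeriv μ X r w) 0 / (t : ℂ))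
        ((𝓝[>] (0:ℝ)) ×ˢ atTop) (𝓝 L) ∧
      (∫ ω, (if X ω < x then (starRingEnd ℂ) (rcpow (X ω) r) else 0) ∂μ)
        + (1 / 2) * (∫ ω, (if X ω = x then (starRingEnd ℂ) (rcpow (X ω) r) else 0) ∂μ)
        = fracDeriv μ X r 0 / (2 * Complex.I ^ ((r : ℝ) : ℂ))
          - ((-1 : ℂ) ^ m
              / (2 * Real.pi * Complex.I ^ ((r + 1 : ℝ) : ℂ) * ((2 * m).choose m))) * L := by
  set c : Ω → ℂ := fun ω => (starRingEnd ℂ) (rcpow (X ω) r) with hcdef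
  have hc : Integrable c μ := integrable_conj_rcpow hX hmom
  have hy : Measurable fun ω => X ω - x := hX.sub_const x
  have hIr : Complex.I ^ (r : ℂ) ≠ 0 := by simp [Complex.cpow_eq_zero_iff]
  refine ⟨Complex.I ^ (r : ℂ) * Complex.I * ∫ ω, c ω *
    ((Real.pi * ((-1) ^ m * (2 * m).choose m) * Real.sign (X ω - x) : ℝ) : ℂ) ∂μ, ?_, ?_⟩
  · simp_rw [deltaPow_exp_mul_fracDeriv_div ⟨m, rfl⟩ hX hc]
    simp_rw [intervalIntegral.integral_const_mul]
    exact (tendsto_integral_integral_symmSin m hc hy).const_mul _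
  · have hsign : Integrable (fun ω => c ω * (Real.sign (X ω - x) : ℂ)) μ :=
      hc.mul_bdd (c := 1)
        (Complex.measurable_ofReal.comp (measurable_sign.comp hy)).aestronglyMeasurable
        (Eventually.of_forall fun ω => by
          rcases Real.sign_apply_eq (X ω - x) with h | h | h <;> simp [h])
    have hlt : Integrable (fun ω => if X ω < x then c ω else 0) μ := by
      refine (hc.indicator (measurableSet_lt hX (measurable_const (a := x)))).congr
        (Eventually.of_forall fun ω => ?_)
      simp [indicator_apply]
    have heq : Integrable (fun ω => if X ω = x then c ω else 0) μ := by
      refine (hc.indicator (measurableSet_eq_fun hX (measurable_const (a := x)))).congr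
        (Eventually.of_forall fun ω => ?_)
      simp [indicator_apply]
    have hF : fracDeriv μ X r 0 = Complex.I ^ (r : ℂ) * ∫ ω, c ω ∂μ := by
      simp [fracDeriv, hcdef]
    have hconst : ∫ ω, c ω *
        ((Real.pi * ((-1) ^ m * (2 * m).choose m) * Real.sign (X ω - x) : ℝ) : ℂ) ∂μ
        = Real.pi * ((-1) ^ m * (2 * m).choose m) * ∫ ω, c ω * (Real.sign (X ω - x) : ℂ) ∂μ := by
      rw [← integral_const_mul]
      congr 1 with ω
      push_cast
      ring
    have hpow : Complex.I ^ ((r + 1 : ℝ) : ℂ) = Complex.I ^ (r : ℂ) * Complex.I := by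
      rw [Complex.ofReal_add, Complex.cpow_add _ _ Complex.I_ne_zero, Complex.ofReal_one,
        Complex.cpow_one]
    have hmain : (∫ ω, (if X ω < x then c ω else 0) ∂μ)
        + (1 / 2) * (∫ ω, (if X ω = x then c ω else 0) ∂μ)
        = (1 / 2) * (∫ ω, c ω ∂μ) - (1 / 2) * ∫ ω, c ω * (Real.sign (X ω - x) : ℂ) ∂μ := by
      rw [← integral_const_mul, ← integral_const_mul, ← integral_const_mul,
        ← integral_add hlt (heq.const_mul _), ← integral_sub (hc.const_mul _) (hsign.const_mul _)]
      congr 1 with ω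
      rcases lt_trichotomy (X ω) x with h | h | h
      · rw [Real.sign_of_neg (sub_neg.2 h), if_pos h, if_neg h.ne]
        push_cast
        ring
      · rw [h]
        simp
      · rw [Real.sign_of_pos (sub_pos.2 h), if_neg h.not_gt, if_neg h.ne']
        simp
    have hpi : (Real.pi : ℂ) ≠ 0 := by exact_mod_cast Real.pi_ne_zero
    have hch : ((2 * m).choose m : ℂ) ≠ 0 := by
      exact_mod_cast (Nat.choose_pos (by omega : m ≤ 2 * m)).ne'
    have hone : ((-1 : ℂ) ^ m) * (-1) ^ m = 1 := by rw [← mul_pow]; simp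
    rw [hmain, hF, hconst, hpow]
    have hI := Complex.I_ne_zero
    generalize ∫ ω, c ω * (Real.sign (X ω - x) : ℂ) ∂μ = S
    field_simp
    linear_combination S * hone
end

section
/- Let x ∈ ℝ, let p ∈ (0,∞) \ ℕ, and set ℓ := ⌈p−1⌉ and e_ℓ(z) := e^z − Σ_{j=0}^{ℓ} z^j/j!. Then the function t ↦ e_ℓ(itx)/t^{p+1} is Lebesgue integrable on (0,∞) and ∫_0^∞ e_ℓ(itx)/t^{p+1} dt = Γ(−p)·(i·sgn x)^{−p}·|x|^p, where the right-hand side is interpreted as 0 when x = 0. Moreover, for any x ≠ 0 and any p ∈ (−1,0), the limit lim_{T↑∞} ∫_0^T e^{itx}/t^{p+1} dt exists and equals Γ(−p)·(i·sgn x)^{−p}·|x|^p. -/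
open MeasureTheory Filter Set Topology

/-- The exponential minus the first `k` terms of its Taylor series at the origin. -/
noncomputable def expTail (k : ℕ) (z : ℂ) : ℂ :=
  Complex.exp z - ∑ j ∈ Finset.range k, z ^ j / (Nat.factorial j)

lemma expTail_zero (z : ℂ) : expTail 0 z = Complex.exp z := by simp [expTail]

lemma expTail_succ (k : ℕ) (z : ℂ) :
    expTail (k + 1) z = expTail k z - z ^ k / (Nat.factorial k) := by
  simp [expTail, Finset.sum_range_succ, sub_sub]

lemma expTail_succ_apply_zero (k : ℕ) : expTail (k + 1) 0 = 0 := by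
  simp [expTail, Finset.sum_range_succ']

lemma hasDerivAt_expTail_succ (k : ℕ) (z : ℂ) :
    HasDerivAt (expTail (k + 1)) (expTail k z) z := by
  induction k with
  | zero =>
    have h := (Complex.hasDerivAt_exp z).sub_const (1 : ℂ)
    simpa [funext (expTail_succ 0), expTail_zero, expTail] using h
  | succ k ih =>
    rw [funext (expTail_succ (k + 1)), expTail_succ k z]
    refine (ih.sub ((hasDerivAt_pow (k + 1) z).div_const
      ((k + 1).factorial : ℂ))).congr_deriv ?_
    have : ((k : ℂ) + 1) ≠ 0 := by exact_mod_cast k.succ_ne_zero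
    have : (k.factorial : ℂ) ≠ 0 := by exact_mod_cast k.factorial_ne_zero
    rw [Nat.factorial_succ]
    push_cast
    field_simp

lemma continuous_expTail (k : ℕ) : Continuous (expTail k) := by
  unfold expTail
  fun_prop

lemma norm_expTail_le (k : ℕ) {z : ℂ} (hz : z.re ≤ 0) : ‖expTail k z‖ ≤ ‖z‖ ^ k := by
  induction k generalizing z with
  | zero => simpa [expTail_zero, Complex.norm_exp] using hz
  | succ k ih =>
    have hconv : Convex ℝ ({w : ℂ | w.re ≤ 0} ∩ Metric.closedBall 0 ‖z‖) :=
      (convex_halfSpace_re_le 0).inter (convex_closedBall _ _)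
    have h := hconv.norm_image_sub_le_of_norm_hasDerivWithin_le (C := ‖z‖ ^ k)
      (fun w _ => (hasDerivAt_expTail_succ k w).hasDerivWithinAt)
      (fun w hw => (ih hw.1).trans (by
        have := hw.2
        rw [mem_closedBall_zero_iff] at this
        gcongr)) (x := 0) (y := z) (by simp) (by simpa using hz)
    simpa [expTail_succ_apply_zero, pow_succ] using h

lemma norm_expTail_succ_le (k : ℕ) {z : ℂ} (hz : z.re ≤ 0) :
    ‖expTail (k + 1) z‖ ≤ 2 * ‖z‖ ^ k := by
  rw [expTail_succ, two_mul]
  refine (norm_sub_le _ _).trans (add_le_add (norm_expTail_le k hz) ?_)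
  rw [norm_div, norm_pow, Complex.norm_natCast]
  exact div_le_self (by positivity) (by exact_mod_cast k.factorial_pos)

lemma norm_rpow_mul_expTail_le (k : ℕ) (q : ℝ) {w : ℂ} (hw : w.re ≤ 0) {t : ℝ} (ht : 0 < t) :
    ‖((t ^ q : ℝ) : ℂ) * expTail k (w * t)‖ ≤ ‖w‖ ^ k * t ^ (q + k) := by
  have hre : (w * t).re ≤ 0 := by
    simpa using mul_nonpos_of_nonpos_of_nonneg hw ht.le
  rw [norm_mul, Complex.norm_real, Real.norm_of_nonneg (by positivity), Real.rpow_add_natCast ht.ne']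
  have h := norm_expTail_le k hre
  rw [norm_mul, Complex.norm_real, Real.norm_of_nonneg ht.le, mul_pow] at h
  calc _ ≤ t ^ q * (‖w‖ ^ k * t ^ k) := by gcongr
    _ = _ := by ring

lemma norm_rpow_mul_expTail_succ_le (k : ℕ) (q : ℝ) {w : ℂ} (hw : w.re ≤ 0) {t : ℝ}
    (ht : 0 < t) :
    ‖((t ^ q : ℝ) : ℂ) * expTail (k + 1) (w * t)‖ ≤ 2 * ‖w‖ ^ k * t ^ (q + k) := by
  have hre : (w * t).re ≤ 0 := by
    simpa using mul_nonpos_of_nonpos_of_nonneg hw ht.le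
  rw [norm_mul, Complex.norm_real, Real.norm_of_nonneg (by positivity), Real.rpow_add_natCast ht.ne']
  have h := norm_expTail_succ_le k hre
  rw [norm_mul, Complex.norm_real, Real.norm_of_nonneg ht.le, mul_pow] at h
  calc _ ≤ t ^ q * (2 * (‖w‖ ^ k * t ^ k)) := by gcongr
    _ = _ := by ring

lemma measurable_rpow_mul_expTail (k : ℕ) (q : ℝ) (w : ℂ) :
    Measurable fun t : ℝ => ((t ^ q : ℝ) : ℂ) * expTail k (w * t) := by
  have := (continuous_expTail k).measurable
  fun_prop

/-- A dominating function, uniform over `‖w‖ ≤ M`. -/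
lemma exists_bound_rpow_mul_expTail_succ (k : ℕ) {p : ℝ} (hkp : k < p) (hpk : p < k + 1) (M : ℝ) :
    ∃ g : ℝ → ℝ, IntegrableOn g (Ioi 0) ∧ ∀ w : ℂ, w.re ≤ 0 → ‖w‖ ≤ M → ∀ t ∈ Ioi (0 : ℝ),
      ‖((t ^ (-p - 1) : ℝ) : ℂ) * expTail (k + 1) (w * t)‖ ≤ g t := by
  refine ⟨fun t => if t ≤ 1 then M ^ (k + 1) * t ^ ((k : ℝ) - p) else
    2 * M ^ k * t ^ ((k : ℝ) - p - 1), ?_, ?_⟩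
  · rw [← Ioc_union_Ioi_eq_Ioi zero_le_one]
    refine IntegrableOn.union ?_ ?_
    · have h := (intervalIntegral.intervalIntegrable_rpow' (a := 0) (b := 1)
        (r := (k : ℝ) - p) (by linarith)).const_mul (M ^ (k + 1))
      rw [intervalIntegrable_iff_integrableOn_Ioc_of_le zero_le_one] at h
      exact h.congr_fun (fun t ht => by simp [ht.2]) measurableSet_Ioc
    · have h := (integrableOn_Ioi_rpow_of_lt (a := (k : ℝ) - p - 1) (by linarith)
        zero_lt_one).const_mul (2 * M ^ k)
      refine IntegrableOn.congr_fun h (fun t ht => ?_) measurableSet_Ioi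
      simp [not_le.mpr (mem_Ioi.mp ht)]
  · intro w hw hM t ht
    have ht : 0 < t := ht
    dsimp only
    split_ifs
    · refine (norm_rpow_mul_expTail_le (k + 1) _ hw ht).trans ?_
      rw [show -p - 1 + ((k + 1 : ℕ) : ℝ) = (k : ℝ) - p by push_cast; ring]
      gcongr
    · refine (norm_rpow_mul_expTail_succ_le k _ hw ht).trans ?_
      rw [show -p - 1 + (k : ℝ) = (k : ℝ) - p - 1 by ring]
      gcongr

lemma integrableOn_rpow_mul_expTail_succ (k : ℕ) {p : ℝ} (hkp : k < p) (hpk : p < k + 1)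
    {w : ℂ} (hw : w.re ≤ 0) :
    IntegrableOn (fun t : ℝ => ((t ^ (-p - 1) : ℝ) : ℂ) * expTail (k + 1) (w * t)) (Ioi 0) := by
  obtain ⟨g, hg, hb⟩ := exists_bound_rpow_mul_expTail_succ k hkp hpk ‖w‖
  exact Integrable.mono' hg (measurable_rpow_mul_expTail _ _ _).aestronglyMeasurable
    (ae_restrict_of_forall_mem measurableSet_Ioi (hb w hw le_rfl))

lemma continuousWithinAt_rpow_mul_expTail_succ (k : ℕ) {p : ℝ} (hpk : p < k + 1)
    {w : ℂ} (hw : w.re ≤ 0) :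
    ContinuousWithinAt (fun t : ℝ => ((t ^ (-p) : ℝ) : ℂ) * expTail (k + 1) (w * t))
      (Ici 0) 0 := by
  rw [← continuousWithinAt_Ioi_iff_Ici]
  have h0 : Tendsto (fun t : ℝ => ‖w‖ ^ (k + 1) * t ^ (-p + (k + 1 : ℕ))) (𝓝[>] 0) (𝓝 0) := by
    have hpos : 0 < -p + ((k + 1 : ℕ) : ℝ) := by push_cast; linarith
    have h := ((Real.continuousAt_rpow_const 0 _ (Or.inr hpos.le)).tendsto.mono_left
      nhdsWithin_le_nhds : Tendsto _ (𝓝[>] (0 : ℝ)) _).const_mul (‖w‖ ^ (k + 1))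
    rwa [Real.zero_rpow hpos.ne', mul_zero] at h
  have h1 : ((((0 : ℝ) ^ (-p) : ℝ) : ℂ) * expTail (k + 1) (w * (0 : ℝ))) = 0 := by
    simp [expTail_succ_apply_zero]
  rw [ContinuousWithinAt, h1]
  exact squeeze_zero_norm' (eventually_mem_nhdsWithin.mono fun t ht =>
    norm_rpow_mul_expTail_le (k + 1) (-p) hw ht) h0

lemma tendsto_rpow_mul_expTail_succ_atTop (k : ℕ) {p : ℝ} (hkp : k < p)
    {w : ℂ} (hw : w.re ≤ 0) :
    Tendsto (fun t : ℝ => ((t ^ (-p) : ℝ) : ℂ) * expTail (k + 1) (w * t)) atTop (𝓝 0) := by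
  have h0 : Tendsto (fun t : ℝ => 2 * ‖w‖ ^ k * t ^ (-p + k)) atTop (𝓝 0) := by
    have h := (tendsto_rpow_neg_atTop (sub_pos.mpr hkp)).const_mul (2 * ‖w‖ ^ k)
    rw [mul_zero] at h
    exact h.congr fun t => by ring_nf
  exact squeeze_zero_norm' ((eventually_gt_atTop 0).mono fun t ht =>
    norm_rpow_mul_expTail_succ_le k (-p) hw ht) h0

lemma hasDerivAt_rpow_mul_expTail_succ (k : ℕ) (p : ℝ) (w : ℂ) {t : ℝ} (ht : 0 < t) :
    HasDerivAt (fun t : ℝ => ((t ^ (-p) : ℝ) : ℂ) * expTail (k + 1) (w * t))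
      (w * (((t ^ (-p) : ℝ) : ℂ) * expTail k (w * t))
        - p * (((t ^ (-p - 1) : ℝ) : ℂ) * expTail (k + 1) (w * t))) t := by
  have h1 := (Real.hasDerivAt_rpow_const (x := t) (p := -p) (Or.inl ht.ne')).ofReal_comp
  have h2 : HasDerivAt (fun t : ℝ => w * (t : ℂ)) w t := by
    simpa using (Complex.ofRealCLM.hasDerivAt (x := t)).const_mul w
  have h3 := (hasDerivAt_expTail_succ k (w * t)).comp t h2
  refine (h1.mul h3).congr_deriv ?_
  simp only [Function.comp_apply]
  push_cast
  ring

lemma norm_rpow_mul_exp (q : ℝ) (w : ℂ) {t : ℝ} (ht : 0 < t) :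
    ‖((t ^ q : ℝ) : ℂ) * Complex.exp (w * t)‖ = t ^ q * Real.exp (w.re * t) := by
  rw [norm_mul, Complex.norm_real, Real.norm_of_nonneg (by positivity), Complex.norm_exp]
  simp

lemma integrableOn_rpow_mul_exp_mul {q : ℝ} (hq : -1 < q) {c : ℝ} (hc : c < 0) :
    IntegrableOn (fun t : ℝ => t ^ q * Real.exp (c * t)) (Ioi 0) := by
  simpa using integrableOn_rpow_mul_exp_neg_mul_rpow hq one_pos (neg_pos.mpr hc)

lemma integrableOn_rpow_mul_cexp_mul {q : ℝ} (hq : -1 < q) {w : ℂ} (hw : w.re < 0) :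
    IntegrableOn (fun t : ℝ => ((t ^ q : ℝ) : ℂ) * Complex.exp (w * t)) (Ioi 0) :=
  Integrable.mono' (integrableOn_rpow_mul_exp_mul hq hw)
    (by fun_prop : Measurable _).aestronglyMeasurable
    (ae_restrict_of_forall_mem measurableSet_Ioi fun _ ht => (norm_rpow_mul_exp q w ht).le)

lemma differentiableOn_integral_rpow_mul_cexp_mul {q : ℝ} (hq : -1 < q) :
    DifferentiableOn ℂ (fun w : ℂ => ∫ t in Ioi (0 : ℝ), ((t ^ q : ℝ) : ℂ) * Complex.exp (w * t))
      {w | w.re < 0} := by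
  intro w hw
  have hw : w.re < 0 := hw
  have hs : {v : ℂ | v.re < w.re / 2} ∈ 𝓝 w :=
    (isOpen_lt Complex.continuous_re continuous_const).mem_nhds
      (show w.re < w.re / 2 by linarith)
  refine (hasDerivAt_integral_of_dominated_loc_of_deriv_le (μ := volume.restrict (Ioi 0)) hs
    (F := fun v t => ((t ^ q : ℝ) : ℂ) * Complex.exp (v * t))
    (F' := fun v t => ((t ^ (q + 1) : ℝ) : ℂ) * Complex.exp (v * t))
    (bound := fun t => t ^ (q + 1) * Real.exp (w.re / 2 * t))
    (.of_forall fun v => (by fun_prop : Measurable _).aestronglyMeasurable)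
    (integrableOn_rpow_mul_cexp_mul hq hw) (by fun_prop : Measurable _).aestronglyMeasurable
    (ae_restrict_of_forall_mem measurableSet_Ioi fun t ht v hv => ?_)
    (integrableOn_rpow_mul_exp_mul (by linarith) (by linarith))
    (ae_restrict_of_forall_mem measurableSet_Ioi
      fun t ht v _ => ?_)).2.differentiableAt.differentiableWithinAt
  · have ht : 0 < t := ht
    have hv : v.re < w.re / 2 := hv
    rw [norm_rpow_mul_exp _ _ ht]
    gcongr
  · have ht : 0 < t := ht
    have h := (((hasDerivAt_id v).mul_const (t : ℂ)).cexp).const_mul ((t ^ q : ℝ) : ℂ)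
    refine h.congr_deriv ?_
    rw [Real.rpow_add_one ht.ne']
    push_cast
    simp only [id]
    ring

lemma neg_mem_slitPlane {w : ℂ} (hw : w.re < 0) : -w ∈ Complex.slitPlane :=
  Complex.mem_slitPlane_iff.mpr <| .inl <| by simpa using hw

/-- The Gamma integral with a complex rate `-w` in the open right half-plane. -/
lemma integral_rpow_mul_cexp_mul {p : ℝ} (hp : p < 0) {w : ℂ} (hw : w.re < 0) :
    ∫ t in Ioi (0 : ℝ), ((t ^ (-p - 1) : ℝ) : ℂ) * Complex.exp (w * t)
      = (Real.Gamma (-p) : ℂ) * (-w) ^ (p : ℂ) := by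
  have hopen : IsOpen {w : ℂ | w.re < 0} := isOpen_lt Complex.continuous_re continuous_const
  have hf := (differentiableOn_integral_rpow_mul_cexp_mul
    (q := -p - 1) (by linarith)).analyticOnNhd hopen
  have hg : AnalyticOnNhd ℂ (fun w : ℂ => (Real.Gamma (-p) : ℂ) * (-w) ^ (p : ℂ))
      {w | w.re < 0} := by
    refine DifferentiableOn.analyticOnNhd (fun v hv => ?_) hopen
    exact ((differentiableAt_id.neg.cpow_const
      (neg_mem_slitPlane hv)).const_mul _).differentiableWithinAt
  have hreal : ∀ r : ℝ, 0 < r →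
      ∫ t in Ioi (0 : ℝ), ((t ^ (-p - 1) : ℝ) : ℂ) * Complex.exp ((-r : ℝ) * t)
        = (Real.Gamma (-p) : ℂ) * (-((-r : ℝ) : ℂ)) ^ (p : ℂ) := by
    intro r hr
    have h := Complex.integral_cpow_mul_exp_neg_mul_Ioi (a := ((-p : ℝ) : ℂ)) (r := r)
      (by simpa using hp) hr
    rw [Complex.Gamma_ofReal, one_div, Complex.inv_cpow_ofReal_nonneg hr.le] at h
    rw [mul_comm (Real.Gamma (-p) : ℂ)]
    convert h using 1
    · refine setIntegral_congr_fun measurableSet_Ioi fun t ht => ?_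
      have ht : 0 < t := ht
      rw [Complex.ofReal_cpow ht.le]
      push_cast
      ring_nf
    · push_cast
      rw [Complex.cpow_neg, inv_inv, neg_neg]
  refine hf.eqOn_of_preconnected_of_frequently_eq hg (convex_halfSpace_re_lt 0).isPreconnected
    (z₀ := -1) (by simp) ?_ hw
  have htend : Tendsto (fun r : ℝ => ((-r : ℝ) : ℂ)) (𝓝[≠] 1) (𝓝[≠] (-1)) := by
    refine tendsto_nhdsWithin_iff.mpr ⟨?_, ?_⟩
    · refine (Continuous.tendsto' (by fun_prop) _ _ (by simp)).mono_left nhdsWithin_le_nhds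
    · filter_upwards [self_mem_nhdsWithin] with r hr h
      have h : ((-r : ℝ) : ℂ) = ((-1 : ℝ) : ℂ) := by simpa using h
      exact hr (neg_injective (Complex.ofReal_injective h))
  refine htend.frequently (Eventually.frequently ?_)
  filter_upwards [nhdsWithin_le_nhds (lt_mem_nhds one_pos)] with r hr using hreal r hr

lemma integrableOn_rpow_mul_expTail (k : ℕ) {p : ℝ} (hkp : k - 1 < p) (hpk : p < k)
    {w : ℂ} (hw : w.re < 0) :
    IntegrableOn (fun t : ℝ => ((t ^ (-p - 1) : ℝ) : ℂ) * expTail k (w * t)) (Ioi 0) := by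
  cases k with
  | zero =>
    simp only [expTail_zero]
    exact integrableOn_rpow_mul_cexp_mul (by simp at hpk; linarith) hw
  | succ k =>
    push_cast at hkp hpk
    exact integrableOn_rpow_mul_expTail_succ k (by linarith) hpk hw.le

/-- The step of the functional equation for the right-hand side. -/
lemma Gamma_mul_cpow_sub_one {p : ℝ} (hp : p ≠ 0) {w : ℂ} (hw : w ≠ 0) :
    w * ((Real.Gamma (-(p - 1)) : ℂ) * (-w) ^ ((p - 1 : ℝ) : ℂ))
      = p * ((Real.Gamma (-p) : ℂ) * (-w) ^ (p : ℂ)) := by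
  rw [show -(p - 1) = -p + 1 by ring, Real.Gamma_add_one (neg_ne_zero.mpr hp), Complex.ofReal_sub,
    Complex.ofReal_one, Complex.cpow_sub _ _ (neg_ne_zero.mpr hw), Complex.cpow_one]
  push_cast
  field_simp

lemma integral_rpow_mul_expTail_of_re_neg (k : ℕ) {p : ℝ} (hkp : k - 1 < p) (hpk : p < k)
    {w : ℂ} (hw : w.re < 0) :
    ∫ t in Ioi (0 : ℝ), ((t ^ (-p - 1) : ℝ) : ℂ) * expTail k (w * t)
      = (Real.Gamma (-p) : ℂ) * (-w) ^ (p : ℂ) := by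
  have hw0 : w ≠ 0 := by rintro rfl; simp at hw
  induction k generalizing p with
  | zero =>
    simp only [expTail_zero]
    exact integral_rpow_mul_cexp_mul (by simpa using hpk) hw
  | succ k ih =>
    push_cast at hkp hpk
    have hkp' : (k : ℝ) < p := by linarith
    have hp : p ≠ 0 := (k.cast_nonneg.trans_lt hkp').ne'
    have hint := integrableOn_rpow_mul_expTail k (p := p - 1) (by linarith) (by linarith) hw
    have IH := ih (p := p - 1) (by linarith) (by linarith)
    rw [show -(p - 1) - 1 = -p by ring] at hint IH
    have hint' := integrableOn_rpow_mul_expTail_succ k hkp' hpk hw.le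
    have h := integral_Ioi_of_hasDerivAt_of_tendsto
      (continuousWithinAt_rpow_mul_expTail_succ k hpk hw.le)
      (fun t ht => hasDerivAt_rpow_mul_expTail_succ k p w ht)
      ((hint.const_mul w).sub (hint'.const_mul (p : ℂ)))
      (tendsto_rpow_mul_expTail_succ_atTop k hkp' hw.le)
    rw [integral_sub (hint.const_mul w) (hint'.const_mul (p : ℂ)), integral_const_mul,
      integral_const_mul, IH, Gamma_mul_cpow_sub_one hp hw0] at h
    simp only [Complex.ofReal_zero, mul_zero, expTail_succ_apply_zero, sub_zero] at h
    exact (mul_left_cancel₀ (Complex.ofReal_ne_zero.mpr hp) (sub_eq_zero.mp h)).symm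

lemma integral_rpow_mul_expTail_succ (k : ℕ) {p : ℝ} (hkp : k < p) (hpk : p < k + 1)
    {w : ℂ} (hw : w.re ≤ 0) (hws : -w ∈ Complex.slitPlane) :
    ∫ t in Ioi (0 : ℝ), ((t ^ (-p - 1) : ℝ) : ℂ) * expTail (k + 1) (w * t)
      = (Real.Gamma (-p) : ℂ) * (-w) ^ (p : ℂ) := by
  obtain ⟨g, hg, hb⟩ := exists_bound_rpow_mul_expTail_succ k hkp hpk (‖w‖ + 1)
  have htend : Tendsto (fun ε : ℝ => w - ε) (𝓝[>] 0) (𝓝 w) :=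
    (Continuous.tendsto' (by fun_prop) _ _ (by simp)).mono_left nhdsWithin_le_nhds
  have hleft := tendsto_integral_filter_of_dominated_convergence
    (μ := volume.restrict (Ioi (0 : ℝ))) (l := 𝓝[>] (0 : ℝ))
    (F := fun ε t => ((t ^ (-p - 1) : ℝ) : ℂ) * expTail (k + 1) ((w - (ε : ℝ)) * t))
    (f := fun t => ((t ^ (-p - 1) : ℝ) : ℂ) * expTail (k + 1) (w * t)) g
    (.of_forall fun _ => (measurable_rpow_mul_expTail _ _ _).aestronglyMeasurable)
    (by
      filter_upwards [self_mem_nhdsWithin, nhdsWithin_le_nhds (gt_mem_nhds one_pos)] with ε h0 h1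
      have h0 : 0 < ε := h0
      refine ae_restrict_of_forall_mem measurableSet_Ioi (hb _ ?_ ?_)
      · simp only [Complex.sub_re, Complex.ofReal_re]; linarith
      · refine (norm_sub_le _ _).trans ?_
        rw [Complex.norm_real, Real.norm_of_nonneg h0.le]
        gcongr)
    hg (.of_forall fun t =>
      (((continuous_expTail (k + 1)).tendsto _).comp (htend.mul_const (t : ℂ))).const_mul _)
  have hright : Tendsto (fun ε : ℝ => (Real.Gamma (-p) : ℂ) * (-(w - ε)) ^ (p : ℂ)) (𝓝[>] 0)
      (𝓝 ((Real.Gamma (-p) : ℂ) * (-w) ^ (p : ℂ))) :=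
    ((continuousAt_cpow_const hws).tendsto.comp htend.neg).const_mul _
  refine tendsto_nhds_unique (hleft.congr' ?_) hright
  filter_upwards [self_mem_nhdsWithin] with ε h0
  have h0 : 0 < ε := h0
  refine integral_rpow_mul_expTail_of_re_neg (k + 1) (by push_cast; linarith)
    (by push_cast; linarith) ?_
  simp only [Complex.sub_re, Complex.ofReal_re]; linarith

/-- The conditionally convergent Gamma integral on the boundary of the half-plane. -/
lemma tendsto_intervalIntegral_rpow_mul_cexp_mul {s : ℝ} (hs : -1 < s) (hs0 : s < 0)
    {w : ℂ} (hw : w.re ≤ 0) (hws : -w ∈ Complex.slitPlane) :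
    Tendsto (fun T : ℝ => ∫ t in (0 : ℝ)..T, ((t ^ (-s - 1) : ℝ) : ℂ) * Complex.exp (w * t))
      atTop (𝓝 ((Real.Gamma (-s) : ℂ) * (-w) ^ (s : ℂ))) := by
  have hw0 : w ≠ 0 := by rintro rfl; simp at hws
  have hkp : ((0 : ℕ) : ℝ) < s + 1 := by simp; linarith
  have hpk : s + 1 < ((0 : ℕ) : ℝ) + 1 := by simpa using hs0
  have hp : s + 1 ≠ 0 := by linarith
  have hint' := integrableOn_rpow_mul_expTail_succ 0 hkp hpk hw
  have hint : ∀ T : ℝ, 0 ≤ T → IntervalIntegrable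
      (fun t : ℝ => ((t ^ (-(s + 1)) : ℝ) : ℂ) * expTail 0 (w * t)) volume 0 T := fun T _ => by
    refine IntervalIntegrable.mul_continuousOn ?_ ?_
    · have h : IntervalIntegrable (fun t : ℝ => t ^ (-(s + 1))) volume 0 T :=
        intervalIntegral.intervalIntegrable_rpow' (by linarith)
      exact ⟨h.1.ofReal, h.2.ofReal⟩
    · have := continuous_expTail 0
      fun_prop
  have hlim := ((tendsto_rpow_mul_expTail_succ_atTop 0 hkp hw).add
    ((intervalIntegral_tendsto_integral_Ioi 0 hint' tendsto_id).const_mul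
      ((s + 1 : ℝ) : ℂ))).const_mul w⁻¹
  rw [integral_rpow_mul_expTail_succ 0 hkp hpk hw hws,
    ← Gamma_mul_cpow_sub_one hp hw0, zero_add (w * _), inv_mul_cancel_left₀ hw0, add_sub_cancel_right] at hlim
  refine hlim.congr' ?_
  filter_upwards [eventually_ge_atTop 0] with T hT
  have hintT : IntervalIntegrable (fun t : ℝ => ((t ^ (-(s + 1) - 1) : ℝ) : ℂ)
      * expTail (0 + 1) (w * t)) volume 0 T :=
    (intervalIntegrable_iff_integrableOn_Ioc_of_le hT).mpr (hint'.mono_set Ioc_subset_Ioi_self)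
  have hcont : ContinuousOn (fun t : ℝ => ((t ^ (-(s + 1)) : ℝ) : ℂ) * expTail (0 + 1) (w * t))
      (Icc 0 T) := by
    intro t ht
    rcases ht.1.eq_or_lt with rfl | h
    · exact (continuousWithinAt_rpow_mul_expTail_succ 0 hpk hw).mono Icc_subset_Ici_self
    · exact (hasDerivAt_rpow_mul_expTail_succ 0 _ w h).continuousAt.continuousWithinAt
  have h := intervalIntegral.integral_eq_sub_of_hasDerivAt_of_le hT hcont
    (fun t ht => hasDerivAt_rpow_mul_expTail_succ 0 (s + 1) w ht.1)
    (((hint T hT).const_mul w).sub (hintT.const_mul ((s + 1 : ℝ) : ℂ)))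
  rw [intervalIntegral.integral_sub ((hint T hT).const_mul w) (hintT.const_mul _),
    intervalIntegral.integral_const_mul, intervalIntegral.integral_const_mul,
    Complex.ofReal_zero, mul_zero w, expTail_succ_apply_zero, mul_zero, sub_zero,
    sub_eq_iff_eq_add] at h
  simp only [id, ← h, inv_mul_cancel_left₀ hw0, expTail_zero]
  ring_nf

lemma neg_I_mul_mem_slitPlane {x : ℝ} (hx : x ≠ 0) : -(Complex.I * x) ∈ Complex.slitPlane :=
  Complex.mem_slitPlane_iff.mpr <| .inr <| by simpa using hx

lemma neg_I_mul_cpow {x : ℝ} (hx : x ≠ 0) (p : ℝ) :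
    (-(Complex.I * x)) ^ (p : ℂ)
      = (Complex.I * (Real.sign x : ℂ)) ^ ((-p : ℝ) : ℂ) * ((|x| ^ p : ℝ) : ℂ) := by
  have hsq : (Real.sign x : ℂ) * Real.sign x = 1 := by
    rcases hx.lt_or_gt with h | h
    · simp [Real.sign_of_neg h]
    · simp [Real.sign_of_pos h]
  have hinv : (Complex.I * (Real.sign x : ℂ))⁻¹ = -(Complex.I * (Real.sign x : ℂ)) :=
    inv_eq_of_mul_eq_one_right <| by
      linear_combination (-Complex.I ^ 2) * hsq - Complex.I_sq
  have harg : (Complex.I * (Real.sign x : ℂ)).arg ≠ Real.pi := by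
    rcases hx.lt_or_gt with h | h
    · simp [Real.sign_of_neg h, Complex.arg_neg_I]; linarith [Real.pi_pos]
    · simp [Real.sign_of_pos h]; linarith [Real.pi_pos]
  have hx' : -(Complex.I * x) = ((|x| : ℝ) : ℂ) * (Complex.I * (Real.sign x : ℂ))⁻¹ := by
    rw [hinv]
    rcases hx.lt_or_gt with h | h
    · simp [Real.sign_of_neg h, abs_of_neg h]; ring
    · simp [Real.sign_of_pos h, abs_of_pos h]; ring
  have hI : (Complex.I * (Real.sign x : ℂ))⁻¹ ≠ 0 := by
    intro h
    rw [h, mul_zero] at hx'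
    exact hx (by simpa using hx')
  rw [hx', Complex.cpow_def_of_ne_zero (mul_ne_zero (by simpa using hx) hI),
    Complex.log_ofReal_mul (abs_pos.mpr hx) hI, add_mul, Complex.exp_add,
    ← Complex.cpow_def_of_ne_zero hI, Complex.inv_cpow _ _ harg, ← Complex.cpow_neg, mul_comm,
    Real.rpow_def_of_pos (abs_pos.mpr hx)]
  push_cast
  rfl

theorem stmt16 (x p : ℝ) (hp : 0 < p) (hpn : ¬∃ n : ℕ, (n : ℝ) = p)
    (ℓ : ℕ) (hl : ℓ = ⌈p - 1⌉₊)
    (e : ℂ → ℂ)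
    (he : e = fun z => Complex.exp z - ∑ j ∈ Finset.range (ℓ + 1), z ^ j / (Nat.factorial j)) :
    (IntegrableOn (fun t : ℝ => e (Complex.I * t * x) / ((t ^ (p + 1) : ℝ) : ℂ))
        (Ioi 0) volume ∧
      (∫ t in Ioi (0:ℝ), e (Complex.I * t * x) / ((t ^ (p + 1) : ℝ) : ℂ))
        = (Real.Gamma (-p) : ℂ) * (Complex.I * (Real.sign x : ℂ)) ^ ((-p : ℝ) : ℂ)
            * ((|x| ^ p : ℝ) : ℂ)) ∧
    ∀ y : ℝ, y ≠ 0 → ∀ s : ℝ, -1 < s → s < 0 →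
      Tendsto
        (fun T => ∫ t in (0:ℝ)..T, Complex.exp (Complex.I * t * y) / ((t ^ (s + 1) : ℝ) : ℂ))
        atTop
        (𝓝 ((Real.Gamma (-s) : ℂ) * (Complex.I * (Real.sign y : ℂ)) ^ ((-s : ℝ) : ℂ)
            * ((|y| ^ s : ℝ) : ℂ))) := by
  have hre : ∀ y : ℝ, (Complex.I * (y : ℂ)).re ≤ 0 := fun y => by simp
  have hform : ∀ (f : ℂ → ℂ) (y q t : ℝ), 0 ≤ t →
      ((t ^ (-q - 1) : ℝ) : ℂ) * f (Complex.I * y * t)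
        = f (Complex.I * t * y) / ((t ^ (q + 1) : ℝ) : ℂ) := fun f y q t ht => by
    rw [show -q - 1 = -(q + 1) by ring, Real.rpow_neg ht, mul_right_comm, Complex.ofReal_inv,
      div_eq_inv_mul]
  have hlp : (ℓ : ℝ) < p := by
    have h : (ℓ : ℝ) ≤ p := by
      rw [hl]
      rcases le_total (p - 1) 0 with h | h
      · rw [Nat.ceil_eq_zero.mpr h]; simpa using hp.le
      · linarith [Nat.ceil_lt_add_one h]
    exact h.lt_of_ne fun h => hpn ⟨ℓ, h⟩
  have hpl : p < ℓ + 1 := by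
    have h : p ≤ ℓ + 1 := by linarith [hl ▸ Nat.le_ceil (p - 1)]
    exact h.lt_of_ne fun h => hpn ⟨ℓ + 1, by rw [h]; push_cast; rfl⟩
  have he : e = expTail (ℓ + 1) := he
  subst he
  refine ⟨⟨(integrableOn_rpow_mul_expTail_succ ℓ hlp hpl (hre x)).congr_fun
    (fun t ht => hform _ x p t (le_of_lt ht)) measurableSet_Ioi, ?_⟩, fun y hy s hs hs0 => ?_⟩
  · rcases eq_or_ne x 0 with rfl | hx
    · simp [expTail_succ_apply_zero, Real.zero_rpow hp.ne']
    · rw [mul_assoc, ← neg_I_mul_cpow hx,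
        ← integral_rpow_mul_expTail_succ ℓ hlp hpl (hre x) (neg_I_mul_mem_slitPlane hx)]
      exact setIntegral_congr_fun measurableSet_Ioi
        fun t ht => (hform _ x p t (le_of_lt ht)).symm
  · rw [mul_assoc, ← neg_I_mul_cpow hy]
    refine (tendsto_intervalIntegral_rpow_mul_cexp_mul hs hs0 (hre y)
      (neg_I_mul_mem_slitPlane hy)).congr' ?_
    filter_upwards [eventually_ge_atTop 0] with T hT
    refine intervalIntegral.integral_congr fun t ht => ?_
    rw [uIcc_of_le hT] at ht
    exact hform Complex.exp y s t ht.1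
end

section
/- For every m ∈ {0,1,2,...}, the limit lim_{T↑∞} ∫_0^T (sin t)^{2m+1}/t dt exists and equals (π/2^{2m+1})·C(2m,m). -/
open Filter Topology

open MeasureTheory Polynomial.Chebyshev

/-- The antiderivative of a damped sine wave. -/
theorem integral_exp_neg_mul_sin (s T : ℝ) :
    ∫ t in (0:ℝ)..T, Real.exp (-s * t) * Real.sin t =
      (1 + s ^ 2)⁻¹ - Real.exp (-s * T) * (Real.cos T + s * Real.sin T) * (1 + s ^ 2)⁻¹ := by
  have hs : 1 + s ^ 2 ≠ 0 := by positivity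
  have key : ∀ t : ℝ, HasDerivAt
      (fun t => -(Real.exp (-s * t) * (Real.cos t + s * Real.sin t) * (1 + s ^ 2)⁻¹))
      (Real.exp (-s * t) * Real.sin t) t := by
    intro t
    have h1 : HasDerivAt (fun t => Real.exp (-s * t)) (Real.exp (-s * t) * (-s)) t := by
      simpa using ((hasDerivAt_id t).const_mul (-s)).exp
    have h2 := (Real.hasDerivAt_cos t).add ((Real.hasDerivAt_sin t).const_mul s)
    refine (((h1.mul h2).mul_const ((1 + s ^ 2)⁻¹)).neg).congr_deriv ?_
    simp only [Pi.add_apply]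
    field_simp
    ring
  rw [intervalIntegral.integral_eq_sub_of_hasDerivAt (fun t _ => key t)
    ((by fun_prop : Continuous fun t => Real.exp (-s * t) * Real.sin t).intervalIntegrable _ _)]
  simp
  ring

theorem abs_cos_add_mul_sin_mul_inv_le_one (s T : ℝ) :
    |(Real.cos T + s * Real.sin T) * (1 + s ^ 2)⁻¹| ≤ 1 := by
  have hs : 0 < 1 + s ^ 2 := by positivity
  rw [abs_mul, abs_of_pos (inv_pos.2 hs), ← div_eq_mul_inv, div_le_one hs]
  apply abs_le_of_sq_le_sq _ hs.le
  nlinarith [Real.sin_sq_add_cos_sq T, sq_nonneg (s * Real.cos T - Real.sin T), sq_nonneg s,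
    sq_nonneg (s ^ 2)]

theorem integral_sinc_eq_integral_Ioi {T : ℝ} (hT : 0 < T) :
    ∫ t in (0:ℝ)..T, Real.sinc t = ∫ s in Set.Ioi (0:ℝ),
      ((1 + s ^ 2)⁻¹ - Real.exp (-s * T) * (Real.cos T + s * Real.sin T) * (1 + s ^ 2)⁻¹) := by
  have hlap : ∀ t ∈ Set.Ioc 0 T,
      ∫ s in Set.Ioi (0:ℝ), Real.exp (-t * s) = t⁻¹ := fun t ht => by
    rw [integral_exp_mul_Ioi (neg_neg_of_pos ht.1)]
    simp
  have hint : Integrable (Function.uncurry fun t s : ℝ => Real.exp (-s * t) * Real.sin t)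
      ((volume.restrict (Set.Ioc 0 T)).prod (volume.restrict (Set.Ioi 0))) := by
    rw [integrable_prod_iff (by
      apply Continuous.aestronglyMeasurable
      unfold Function.uncurry
      fun_prop)]
    constructor
    · filter_upwards [ae_restrict_mem measurableSet_Ioc] with t ht
      have := (integrableOn_exp_mul_Ioi (neg_neg_of_pos ht.1) 0).mul_const (Real.sin t)
      refine this.congr (ae_of_all _ fun s => ?_)
      simp [mul_comm]
    · have h : IntegrableOn (fun t => |Real.sinc t|) (Set.Ioc 0 T) :=
        (Real.continuous_sinc.abs.continuousOn.integrableOn_Icc).mono_set Set.Ioc_subset_Icc_self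
      refine h.congr ?_
      filter_upwards [ae_restrict_mem measurableSet_Ioc] with t ht
      simp only [Function.uncurry, norm_mul, Real.norm_eq_abs, Real.abs_exp]
      rw [integral_mul_const]
      simp_rw [neg_mul, mul_comm _ t, ← neg_mul]
      rw [hlap t ht, Real.sinc_of_ne_zero ht.1.ne', abs_div, abs_of_pos ht.1]
      ring
  calc ∫ t in (0:ℝ)..T, Real.sinc t
      = ∫ t in Set.Ioc 0 T, ∫ s in Set.Ioi (0:ℝ), Real.exp (-s * t) * Real.sin t := by
        rw [intervalIntegral.integral_of_le hT.le]
        refine setIntegral_congr_fun measurableSet_Ioc fun t ht => ?_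
        rw [integral_mul_const]
        simp_rw [neg_mul, mul_comm _ t, ← neg_mul]
        rw [hlap t ht, Real.sinc_of_ne_zero ht.1.ne']
        ring
    _ = _ := by
        rw [integral_integral_swap hint]
        refine integral_congr_ae (ae_of_all _ fun s => ?_)
        simp only
        rw [← intervalIntegral.integral_of_le hT.le, integral_exp_neg_mul_sin]

/-- The Dirichlet integral. -/
theorem tendsto_integral_sinc :
    Tendsto (fun T => ∫ t in (0:ℝ)..T, Real.sinc t) atTop (𝓝 (Real.pi / 2)) := by
  rw [tendsto_iff_norm_sub_tendsto_zero]
  refine squeeze_zero' (Eventually.of_forall fun T => norm_nonneg _) ?_ tendsto_inv_atTop_zero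
  filter_upwards [eventually_gt_atTop 0] with T hT
  have hexp := integrableOn_exp_mul_Ioi (neg_neg_of_pos hT) 0
  have hle : ∀ s : ℝ, ‖Real.exp (-s * T) * (Real.cos T + s * Real.sin T) * (1 + s ^ 2)⁻¹‖ ≤
      Real.exp (-T * s) := fun s => by
    rw [mul_assoc, norm_mul, Real.norm_eq_abs, Real.norm_eq_abs, Real.abs_exp,
      show -s * T = -T * s by ring]
    exact mul_le_of_le_one_right (Real.exp_pos _).le (abs_cos_add_mul_sin_mul_inv_le_one s T)
  have hI : IntegrableOn
      (fun s => Real.exp (-s * T) * (Real.cos T + s * Real.sin T) * (1 + s ^ 2)⁻¹)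
      (Set.Ioi 0) := by
    refine hexp.mono' (Measurable.aestronglyMeasurable (by fun_prop)) (ae_of_all _ hle)
  rw [integral_sinc_eq_integral_Ioi hT, integral_sub integrable_inv_one_add_sq.integrableOn hI,
    integral_Ioi_inv_one_add_sq, Real.arctan_zero, sub_zero, sub_sub_cancel_left, norm_neg]
  refine (norm_integral_le_of_norm_le hexp (ae_of_all _ hle)).trans_eq ?_
  rw [integral_exp_mul_Ioi (neg_neg_of_pos hT)]
  simp

/-- Lobachevsky's formula for a continuous function `g`, in terms of `sinc`. -/
def LobachevskyFormula (g : ℝ → ℝ) : Prop :=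
  Continuous g ∧ Tendsto (fun T => ∫ t in (0:ℝ)..T, g t * Real.sinc t) atTop
    (𝓝 ((∫ t in (0:ℝ)..Real.pi, g t) / 2))

namespace LobachevskyFormula

theorem add {f g : ℝ → ℝ} (hf : LobachevskyFormula f) (hg : LobachevskyFormula g) :
    LobachevskyFormula (fun t => f t + g t) := by
  obtain ⟨cf, hf⟩ := hf
  obtain ⟨cg, hg⟩ := hg
  refine ⟨cf.add cg, ?_⟩
  have h := hf.add hg
  rw [← add_div, ← intervalIntegral.integral_add (cf.intervalIntegrable _ _)
    (cg.intervalIntegrable _ _)] at h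
  refine h.congr fun T => ?_
  simp_rw [add_mul]
  exact (intervalIntegral.integral_add ((cf.mul Real.continuous_sinc).intervalIntegrable _ _)
    ((cg.mul Real.continuous_sinc).intervalIntegrable _ _)).symm

theorem const_mul {f : ℝ → ℝ} (hf : LobachevskyFormula f) (c : ℝ) :
    LobachevskyFormula (fun t => c * f t) := by
  obtain ⟨cf, hf⟩ := hf
  refine ⟨cf.const_mul c, ?_⟩
  have h := hf.const_mul c
  rw [← mul_div_assoc, ← intervalIntegral.integral_const_mul] at h
  refine h.congr fun T => ?_
  rw [← intervalIntegral.integral_const_mul]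
  simp_rw [mul_assoc]

end LobachevskyFormula

theorem integral_chebyshev_U_cos_even (n : ℕ) :
    ∫ t in (0:ℝ)..Real.pi, (U ℝ (2 * n : ℤ)).eval (Real.cos t) = Real.pi := by
  induction n with
  | zero => simp
  | succ n ih =>
    have h : ∀ t : ℝ, (U ℝ (2 * (n + 1 : ℕ) : ℤ)).eval (Real.cos t) =
        (U ℝ (2 * n : ℤ)).eval (Real.cos t) + 2 * Real.cos ((2 * n + 2 : ℝ) * t) := by
      intro t
      have h1 := congrArg (Polynomial.eval (Real.cos t)) (U_add_two ℝ (2 * n : ℤ))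
      have h2 := congrArg (Polynomial.eval (Real.cos t)) (U_eq_X_mul_U_add_T ℝ (2 * n + 1 : ℤ))
      have h3 := T_real_cos t (2 * n + 2 : ℤ)
      rw [show (2 * n + 1 + 1 : ℤ) = 2 * n + 2 by ring] at h2
      rw [show (2 * (n + 1 : ℕ) : ℤ) = 2 * n + 2 by push_cast; ring]
      simp only [Polynomial.eval_sub, Polynomial.eval_mul, Polynomial.eval_add, Polynomial.eval_X,
        Polynomial.eval_ofNat] at h1 h2
      push_cast at h3
      linear_combination 2 * h2 - h1 + 2 * h3
    have hn : (2 * n + 2 : ℝ) ≠ 0 := by positivity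
    have hsin : Real.sin ((2 * n + 2 : ℝ) * Real.pi) = 0 := by
      exact_mod_cast Real.sin_nat_mul_pi (2 * n + 2)
    simp_rw [h]
    rw [intervalIntegral.integral_add (Continuous.intervalIntegrable (by fun_prop) _ _)
      (Continuous.intervalIntegrable (by fun_prop) _ _), ih, intervalIntegral.integral_const_mul,
      intervalIntegral.integral_comp_mul_left _ hn]
    simp [hsin]

theorem chebyshev_U_cos_mul_sinc (n : ℕ) (t : ℝ) :
    (U ℝ (2 * n : ℤ)).eval (Real.cos t) * Real.sinc t =
      (2 * n + 1) * Real.sinc ((2 * n + 1) * t) := by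
  rcases eq_or_ne t 0 with rfl | ht
  · simp
  · have hn : (2 * n + 1 : ℝ) ≠ 0 := by positivity
    have h := U_real_cos t (2 * n : ℤ)
    push_cast at h
    rw [Real.sinc_of_ne_zero ht, Real.sinc_of_ne_zero (mul_ne_zero hn ht), ← h]
    field_simp

theorem lobachevskyFormula_chebyshev_U_cos_nat (n : ℕ) :
    LobachevskyFormula (fun t => (U ℝ (2 * n : ℤ)).eval (Real.cos t)) := by
  refine ⟨by fun_prop, ?_⟩
  have hn : (0:ℝ) < 2 * n + 1 := by positivity
  rw [integral_chebyshev_U_cos_even]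
  refine (tendsto_integral_sinc.comp (tendsto_id.const_mul_atTop hn)).congr fun T => ?_
  simp_rw [chebyshev_U_cos_mul_sinc]
  rw [intervalIntegral.integral_const_mul, intervalIntegral.integral_comp_mul_left _ hn.ne']
  simp [hn.ne']

theorem lobachevskyFormula_chebyshev_U_cos (j : ℤ) :
    LobachevskyFormula (fun t => (U ℝ (2 * j)).eval (Real.cos t)) := by
  rcases le_or_gt 0 j with hj | hj
  · lift j to ℕ using hj
    exact lobachevskyFormula_chebyshev_U_cos_nat j
  · obtain ⟨n, hn⟩ := Int.eq_ofNat_of_zero_le (show 0 ≤ -j - 1 by lia)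
    convert (lobachevskyFormula_chebyshev_U_cos_nat n).const_mul (-1) using 2 with t
    rw [show 2 * j = -(2 * n : ℤ) - 2 by lia, U_neg_sub_two]
    simp

theorem lobachevskyFormula_sin_pow_mul_chebyshev_U_cos (m : ℕ) (j : ℤ) :
    LobachevskyFormula (fun t => Real.sin t ^ (2 * m) * (U ℝ (2 * j)).eval (Real.cos t)) := by
  induction m generalizing j with
  | zero => simpa using lobachevskyFormula_chebyshev_U_cos j
  | succ m ih =>
    convert ((ih j).const_mul (1 / 2)).add
      (((ih (j + 1)).add (ih (j - 1))).const_mul (-1 / 4)) using 2 with t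
    have h1 := congrArg (Polynomial.eval (Real.cos t)) (U_add_two ℝ (2 * j))
    have h2 := congrArg (Polynomial.eval (Real.cos t)) (U_sub_two ℝ (2 * j))
    have h3 := congrArg (Polynomial.eval (Real.cos t)) (U_add_one ℝ (2 * j))
    rw [show 2 * (j + 1) = 2 * j + 2 by ring, show 2 * (j - 1) = 2 * j - 2 by ring, h1, h2]
    simp only [Polynomial.eval_sub, Polynomial.eval_mul, Polynomial.eval_X,
      Polynomial.eval_ofNat] at h3 ⊢
    rw [h3, show 2 * (m + 1) = 2 * m + 2 by ring, pow_add, Real.sin_sq]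
    ring

theorem integral_sin_pow_even_eq_choose (m : ℕ) :
    ∫ t in (0:ℝ)..Real.pi, Real.sin t ^ (2 * m) =
      Real.pi / 2 ^ (2 * m) * ((2 * m).choose m) := by
  rw [integral_sin_pow_even, div_mul_eq_mul_div, mul_div_assoc, ← Nat.centralBinom_eq_two_mul_choose]
  congr 1
  induction m with
  | zero => simp
  | succ m ih =>
    have h : ((m + 1 : ℝ)) * (m + 1).centralBinom = 2 * (2 * m + 1) * m.centralBinom := by
      exact_mod_cast Nat.succ_mul_centralBinom_succ m
    rw [Finset.prod_range_succ, ih, show 2 * (m + 1) = 2 * m + 2 by ring, pow_add]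
    field_simp
    linear_combination -h

theorem stmt18 (m : ℕ) :
    Tendsto (fun T => ∫ t in (0:ℝ)..T, (Real.sin t) ^ (2 * m + 1) / t) atTop
      (𝓝 (Real.pi / 2 ^ (2 * m + 1) * ((2 * m).choose m))) := by
  have h := (lobachevskyFormula_sin_pow_mul_chebyshev_U_cos m 0).2
  simp only [mul_zero, U_zero, Polynomial.eval_one, mul_one, integral_sin_pow_even_eq_choose] at h
  rw [show Real.pi / 2 ^ (2 * m + 1) * ((2 * m).choose m) =
    Real.pi / 2 ^ (2 * m) * ((2 * m).choose m) / 2 by rw [pow_succ]; field_simp]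
  refine h.congr' ?_
  filter_upwards [eventually_ge_atTop 0] with T hT
  refine intervalIntegral.integral_congr_Ioo_of_le hT fun t ht => ?_
  rw [Real.sinc_of_ne_zero ht.1.ne', pow_succ, mul_div_assoc]
end

section
/- Let n ∈ ℕ and let p be real with 0 < p < n if n is even and −1 < p < n if n is odd. Then the limit c_{p,n} := lim_{ε↓0, T↑∞} ∫_ε^T (sin t)^n/t^{p+1} dt exists and satisfies c_{p,n} > 0. -/
open MeasureTheory Filter Set Topology

/-- A continuous function bounded both by `C` and by `t ^ m` is integrable on `(0, ∞)` against
`t ^ (-(r + 1))` when `0 < r < m`. -/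
lemma integrableOn_div_rpow_Ioi {g : ℝ → ℝ} (hg : Continuous g) {C r m : ℝ}
    (hr : 0 < r) (hrm : r < m) (hgC : ∀ t, |g t| ≤ C) (hgm : ∀ t, 0 < t → |g t| ≤ t ^ m) :
    IntegrableOn (fun t => g t / t ^ (r + 1)) (Ioi 0) := by
  have hmeas (s : Set ℝ) :
      AEStronglyMeasurable (fun t => g t / t ^ (r + 1)) (volume.restrict s) :=
    (hg.measurable.div (measurable_id.pow_const _)).aestronglyMeasurable
  rw [← Ioc_union_Ioi_eq_Ioi (zero_le_one' ℝ)]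
  refine IntegrableOn.union ?_ ?_
  · have hi : IntegrableOn (fun t : ℝ => t ^ (m - (r + 1))) (Ioc 0 1) :=
      (intervalIntegrable_iff_integrableOn_Ioc_of_le zero_le_one).1
        (intervalIntegral.intervalIntegrable_rpow' (by linarith))
    refine Integrable.mono' hi (hmeas _) ?_
    filter_upwards [ae_restrict_mem measurableSet_Ioc] with t ht
    rw [norm_div, Real.norm_eq_abs, Real.norm_of_nonneg (Real.rpow_nonneg ht.1.le _),
      Real.rpow_sub ht.1]
    exact div_le_div_of_nonneg_right (hgm t ht.1) (Real.rpow_nonneg ht.1.le _)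
  · have hi : IntegrableOn (fun t : ℝ => C * t ^ (-(r + 1))) (Ioi 1) :=
      (integrableOn_Ioi_rpow_of_lt (by linarith) one_pos).const_mul C
    refine Integrable.mono' hi (hmeas _) ?_
    filter_upwards [ae_restrict_mem measurableSet_Ioi] with t ht
    have ht0 : (0 : ℝ) < t := one_pos.trans ht
    rw [norm_div, Real.norm_eq_abs, Real.norm_of_nonneg (Real.rpow_nonneg ht0.le _),
      Real.rpow_neg ht0.le, ← div_eq_mul_inv]
    exact div_le_div_of_nonneg_right (hgC t) (Real.rpow_nonneg ht0.le _)

lemma tendsto_intervalIntegral_nhdsGT_atTop {h : ℝ → ℝ} (hh : IntegrableOn h (Ioi 0)) :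
    Tendsto (fun s : ℝ × ℝ => ∫ t in s.1..s.2, h t) ((𝓝[>] (0 : ℝ)) ×ˢ atTop)
      (𝓝 (∫ t in Ioi 0, h t)) := by
  have hint {a : ℝ} (ha : 0 ≤ a) : IntervalIntegrable h volume 0 a :=
    (intervalIntegrable_iff_integrableOn_Ioc_of_le ha).2 (hh.mono_set Ioc_subset_Ioi_self)
  have hT := intervalIntegral_tendsto_integral_Ioi 0 hh tendsto_id
  have hε : Tendsto (fun a => ∫ t in (0 : ℝ)..a, h t) (𝓝[>] 0) (𝓝 0) := by
    have hc : ContinuousOn (fun a => ∫ t in (0 : ℝ)..a, h t) (uIcc 0 1) := by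
      refine intervalIntegral.continuousOn_primitive_interval ?_
      rw [uIcc_of_le zero_le_one, integrableOn_Icc_iff_integrableOn_Ioc]
      exact hh.mono_set Ioc_subset_Ioi_self
    have := hc 0 left_mem_uIcc
    rw [ContinuousWithinAt, intervalIntegral.integral_same, uIcc_of_le zero_le_one] at this
    refine this.mono_left ?_
    rw [← nhdsWithin_Ioc_eq_nhdsGT (zero_lt_one' ℝ)]
    exact nhdsWithin_mono _ Ioc_subset_Icc_self
  have := (hT.comp tendsto_snd).sub (hε.comp (tendsto_fst (g := (atTop : Filter ℝ))))
  rw [sub_zero] at this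
  refine this.congr' ?_
  filter_upwards [prod_mem_prod self_mem_nhdsWithin (Ici_mem_atTop (0 : ℝ))] with s hs
  exact intervalIntegral.integral_interval_sub_left (hint hs.2) (hint (le_of_lt hs.1))

lemma exists_pos_tendsto_integral_div_rpow {g : ℝ → ℝ} (hg : Continuous g) {C r m : ℝ}
    (hr : 0 < r) (hrm : r < m) (hg0 : ∀ t, 0 ≤ g t) (hgC : ∀ t, g t ≤ C)
    (hgm : ∀ t, 0 < t → g t ≤ t ^ m) (hpos : ∀ t ∈ Ioo (0 : ℝ) 1, 0 < g t) :
    ∃ c : ℝ, 0 < c ∧ Tendsto (fun s : ℝ × ℝ => ∫ t in s.1..s.2, g t / t ^ (r + 1))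
      ((𝓝[>] (0 : ℝ)) ×ˢ atTop) (𝓝 c) := by
  have hI : IntegrableOn (fun t => g t / t ^ (r + 1)) (Ioi 0) :=
    integrableOn_div_rpow_Ioi hg hr hrm (fun t => by rw [abs_of_nonneg (hg0 t)]; exact hgC t)
      (fun t ht => by rw [abs_of_nonneg (hg0 t)]; exact hgm t ht)
  refine ⟨_, ?_, tendsto_intervalIntegral_nhdsGT_atTop hI⟩
  have h01 : 0 < ∫ t in (0 : ℝ)..1, g t / t ^ (r + 1) :=
    intervalIntegral.intervalIntegral_pos_of_pos_on
      ((intervalIntegrable_iff_integrableOn_Ioc_of_le zero_le_one).2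
        (hI.mono_set Ioc_subset_Ioi_self))
      (fun t ht => div_pos (hpos t ht) (Real.rpow_pos_of_pos ht.1 _)) one_pos
  rw [intervalIntegral.integral_of_le zero_le_one] at h01
  refine h01.trans_le (setIntegral_mono_set hI ?_ Ioc_subset_Ioi_self.eventuallyLE)
  filter_upwards [ae_restrict_mem measurableSet_Ioi] with t ht
  exact div_nonneg (hg0 t) (Real.rpow_nonneg (le_of_lt ht) _)

lemma abs_integral_sin_pow_le (n : ℕ) {t : ℝ} (ht : 0 ≤ t) :
    |∫ u in (0 : ℝ)..t, Real.sin u ^ n| ≤ t ^ (n + 1) := by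
  have := intervalIntegral.norm_integral_le_of_norm_le_const (a := (0 : ℝ)) (b := t)
    (f := fun u => Real.sin u ^ n) (C := t ^ n) (fun u hu => by
      rw [uIoc_of_le ht] at hu
      rw [norm_pow, Real.norm_eq_abs]
      have h1 : |Real.sin u| ≤ |u| := Real.abs_sin_le_abs
      rw [abs_of_pos hu.1] at h1
      exact pow_le_pow_left₀ (abs_nonneg _) (h1.trans hu.2) n)
  rwa [sub_zero, abs_of_nonneg ht, ← pow_succ] at this

lemma integral_sin_pow_odd_mem_Icc (k : ℕ) (t : ℝ) :
    ∫ u in (0 : ℝ)..t, Real.sin u ^ (2 * k + 1) ∈ Icc (0 : ℝ) 2 := by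
  have h := integral_sin_pow_odd_mul_cos_pow (a := 0) (b := t) k 0
  simp only [pow_zero, mul_one, one_mul, Real.cos_zero] at h
  rw [h]
  have hle := Real.cos_le_one t
  have hge := Real.neg_one_le_cos t
  have hmem : ∀ u ∈ Icc (Real.cos t) 1, 0 ≤ 1 - u ^ 2 := fun u hu => by
    nlinarith [hu.1, hu.2]
  constructor
  · exact intervalIntegral.integral_nonneg hle fun u hu => pow_nonneg (hmem u hu) k
  · have := intervalIntegral.integral_mono_on (μ := volume) hle
      (Continuous.intervalIntegrable (u := fun u : ℝ => (1 - u ^ 2) ^ k) (by fun_prop) _ _)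
      (continuous_const.intervalIntegrable (u := fun _ : ℝ => (1 : ℝ)) _ _)
      (fun u hu => pow_le_one₀ (hmem u hu) (by nlinarith))
    rw [intervalIntegral.integral_const, smul_eq_mul, mul_one] at this
    linarith

lemma integral_div_rpow_by_parts {f F : ℝ → ℝ} (hf : Continuous f)
    (hF : ∀ t, HasDerivAt F (f t) t) (q : ℝ) {a b : ℝ} (ha : 0 < a) (hb : 0 < b) :
    ∫ t in a..b, f t / t ^ q =
      F b / b ^ q - F a / a ^ q + q * ∫ t in a..b, F t / t ^ (q + 1) := by
  have hpos : ∀ t ∈ uIcc a b, 0 < t := fun t ht => (lt_min ha hb).trans_le ht.1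
  have hv : ∀ t ∈ uIcc a b, HasDerivAt (fun t : ℝ => t ^ (-q)) (-q * t ^ (-q - 1)) t :=
    fun t ht => Real.hasDerivAt_rpow_const (Or.inl (hpos t ht).ne')
  have hv' : IntervalIntegrable (fun t : ℝ => -q * t ^ (-q - 1)) volume a b :=
    ContinuousOn.intervalIntegrable fun t ht =>
      ((Real.continuousAt_rpow_const _ _ (Or.inl (hpos t ht).ne')).const_mul _).continuousWithinAt
  have key := intervalIntegral.integral_deriv_mul_eq_sub
    (fun t _ => hF t) hv (hf.intervalIntegrable _ _) hv'
  have hi1 : IntervalIntegrable (fun t => f t / t ^ q) volume a b :=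
    ContinuousOn.intervalIntegrable fun t ht =>
      (hf.continuousAt.div (Real.continuousAt_rpow_const _ _ (Or.inl (hpos t ht).ne'))
        (Real.rpow_pos_of_pos (hpos t ht) _).ne').continuousWithinAt
  have hi2 : IntervalIntegrable (fun t => F t / t ^ (q + 1)) volume a b :=
    ContinuousOn.intervalIntegrable fun t ht =>
      ((hF t).continuousAt.div (Real.continuousAt_rpow_const _ _ (Or.inl (hpos t ht).ne'))
        (Real.rpow_pos_of_pos (hpos t ht) _).ne').continuousWithinAt
  have hcongr : ∫ t in a..b, f t * t ^ (-q) + F t * (-q * t ^ (-q - 1)) =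
      ∫ t in a..b, f t / t ^ q - q * (F t / t ^ (q + 1)) := by
    refine intervalIntegral.integral_congr fun t ht => ?_
    have ht0 := (hpos t ht).le
    rw [show -q - 1 = -(q + 1) by ring, Real.rpow_neg ht0, Real.rpow_neg ht0]
    ring
  rw [hcongr, intervalIntegral.integral_sub hi1 (hi2.const_mul q),
    intervalIntegral.integral_const_mul, Real.rpow_neg ha.le, Real.rpow_neg hb.le,
    ← div_eq_mul_inv, ← div_eq_mul_inv] at key
  linarith

lemma sin_pow_pos_of_mem_Ioo (n : ℕ) {t : ℝ} (ht : t ∈ Ioo (0 : ℝ) 1) : 0 < Real.sin t ^ n :=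
  pow_pos (Real.sin_pos_of_pos_of_le_one ht.1 ht.2.le) n

lemma exists_pos_tendsto_integral_sin_pow_even {n : ℕ} (hn : Even n) {p : ℝ} (hp : 0 < p)
    (hpn : p < n) :
    ∃ c : ℝ, 0 < c ∧ Tendsto (fun s : ℝ × ℝ => ∫ t in s.1..s.2, Real.sin t ^ n / t ^ (p + 1))
      ((𝓝[>] (0 : ℝ)) ×ˢ atTop) (𝓝 c) := by
  refine exists_pos_tendsto_integral_div_rpow (C := 1) (by fun_prop) hp hpn
    (fun t => hn.pow_nonneg _) (fun t => ?_) (fun t ht => ?_)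
    (fun t ht => sin_pow_pos_of_mem_Ioo n ht)
  · rw [← hn.pow_abs]
    exact pow_le_one₀ (abs_nonneg _) (Real.abs_sin_le_one t)
  · rw [← hn.pow_abs, Real.rpow_natCast]
    have h1 : |Real.sin t| ≤ |t| := Real.abs_sin_le_abs
    rw [abs_of_pos ht] at h1
    exact pow_le_pow_left₀ (abs_nonneg _) h1 n

lemma exists_pos_tendsto_integral_sin_pow_odd {n : ℕ} (hn : Odd n) {q : ℝ} (hq : 0 < q)
    (hqn : q < n + 1) :
    ∃ c : ℝ, 0 < c ∧ Tendsto (fun s : ℝ × ℝ => ∫ t in s.1..s.2, Real.sin t ^ n / t ^ q)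
      ((𝓝[>] (0 : ℝ)) ×ˢ atTop) (𝓝 c) := by
  have hf : Continuous fun t => Real.sin t ^ n := by fun_prop
  set G : ℝ → ℝ := fun t => ∫ u in (0 : ℝ)..t, Real.sin u ^ n
  have hderiv : ∀ t, HasDerivAt G (Real.sin t ^ n) t := fun t =>
    (hf.integral_hasStrictDerivAt 0 t).hasDerivAt
  have hbound : ∀ t, G t ∈ Icc (0 : ℝ) 2 := by
    obtain ⟨k, rfl⟩ := hn
    exact integral_sin_pow_odd_mem_Icc k
  have hpow : ∀ t, 0 < t → G t ≤ t ^ ((n : ℝ) + 1) := fun t ht => by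
    have := (le_abs_self _).trans (abs_integral_sin_pow_le n ht.le)
    exact_mod_cast this
  obtain ⟨c, hc, hlim⟩ := exists_pos_tendsto_integral_div_rpow
    (continuous_iff_continuousAt.2 fun t => (hderiv t).continuousAt) hq hqn
    (fun t => (hbound t).1) (fun t => (hbound t).2) hpow
    (fun t ht => intervalIntegral.intervalIntegral_pos_of_pos_on (hf.intervalIntegrable _ _)
      (fun u hu => sin_pow_pos_of_mem_Ioo n ⟨hu.1, hu.2.trans ht.2⟩) ht.1)
  refine ⟨q * c, mul_pos hq hc, ?_⟩
  have hT : Tendsto (fun t => G t / t ^ q) atTop (𝓝 0) := by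
    refine squeeze_zero' ?_ ?_ ((tendsto_rpow_atTop hq).const_div_atTop 2)
    · filter_upwards [eventually_ge_atTop 0] with t ht
      exact div_nonneg (hbound t).1 (Real.rpow_nonneg ht _)
    · filter_upwards [eventually_ge_atTop 0] with t ht
      exact div_le_div_of_nonneg_right (hbound t).2 (Real.rpow_nonneg ht _)
  have hε : Tendsto (fun t => G t / t ^ q) (𝓝[>] 0) (𝓝 0) := by
    have h0 : Tendsto (fun t : ℝ => t ^ ((n : ℝ) + 1 - q)) (𝓝[>] 0) (𝓝 0) := by
      have := (Real.continuousAt_rpow_const 0 ((n : ℝ) + 1 - q)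
        (Or.inr (by linarith))).tendsto
      rw [Real.zero_rpow (by linarith)] at this
      exact this.mono_left nhdsWithin_le_nhds
    refine squeeze_zero' ?_ ?_ h0
    · filter_upwards [self_mem_nhdsWithin] with t ht
      exact div_nonneg (hbound t).1 (Real.rpow_nonneg (le_of_lt ht) _)
    · filter_upwards [self_mem_nhdsWithin] with t ht
      rw [Real.rpow_sub ht]
      exact div_le_div_of_nonneg_right (hpow t ht) (Real.rpow_nonneg (le_of_lt ht) _)
  have := ((hT.comp tendsto_snd).sub (hε.comp (tendsto_fst (g := (atTop : Filter ℝ))))).add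
    (hlim.const_mul q)
  rw [sub_zero, zero_add] at this
  refine this.congr' ?_
  filter_upwards [prod_mem_prod self_mem_nhdsWithin (Ioi_mem_atTop (0 : ℝ))] with s hs
  exact (integral_div_rpow_by_parts hf hderiv q hs.1 hs.2).symm

theorem stmt19 (n : ℕ) (hn : 1 ≤ n) (p : ℝ)
    (hpe : Even n → 0 < p) (hpo : Odd n → -1 < p) (hpn : p < n) :
    ∃ c : ℝ, 0 < c ∧
      Tendsto
        (fun s : ℝ × ℝ => ∫ t in s.1..s.2, (Real.sin t) ^ n / t ^ (p + 1))
        ((𝓝[>] (0:ℝ)) ×ˢ atTop) (𝓝 c) := by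
  rcases n.even_or_odd with h | h
  · exact exists_pos_tendsto_integral_sin_pow_even h (hpe h) hpn
  · exact exists_pos_tendsto_integral_sin_pow_odd h (by linarith [hpo h]) (by linarith)
end
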